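/- arXiv:1109.4924 — 3 statements merged into one kernel-verified Lean document; each statement's English description precedes it below -/
import Mathlib

section
/- Let n ≥ 1, let Q = [0,1)^n with Lebesgue measure, let p > 1 and let f, F be reals with 0 < f^p ≤ F. Let z ∈ [1, p/(p-1)] satisfy -(p-1)z^p + p z^{p-1} = f^p/F. Then for every nonnegative measurable function φ on Q with ∫_Q φ = f and ∫_Q φ^p = F, one has ∫_Q (Mφ)^p ≤ F · z^p. -/
open MeasureTheory Set Filter

noncomputable section

/-- The unit cube `[0,1)^n` in `ℝ^n`. -/
def unitCube (n : ℕ) : Set (Fin n → ℝ) := Set.univ.pi fun _ => Set.Ico (0:ℝ) 1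

/-- A dyadic subcube of the unit cube: a product of intervals
`[k_i 2^{-N}, (k_i+1) 2^{-N})` with `0 ≤ k_i < 2^N`. -/
def IsDyadicCube (n : ℕ) (R : Set (Fin n → ℝ)) : Prop :=
  ∃ (N : ℕ) (k : Fin n → ℕ), (∀ i, k i < 2 ^ N) ∧
    R = Set.univ.pi fun i => Set.Ico ((k i : ℝ) / 2 ^ N) (((k i : ℝ) + 1) / 2 ^ N)

/-- The (localized) dyadic maximal operator on the unit cube:
`Mφ(x) = sup { (1/|R|) ∫_R φ : x ∈ R, R a dyadic subcube of Q }`. -/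
def dyadicMax (n : ℕ) (φ : (Fin n → ℝ) → ℝ) (x : Fin n → ℝ) : ℝ :=
  sSup { a : ℝ | ∃ R : Set (Fin n → ℝ), IsDyadicCube n R ∧ x ∈ R ∧
    a = ((volume R).toReal)⁻¹ * ∫ y in R, φ y }

/-- The dyadic maximal operator localized to a dyadic subcube `J`:
the supremum is taken only over dyadic subcubes contained in `J`. -/
def dyadicMaxIn (n : ℕ) (J : Set (Fin n → ℝ)) (φ : (Fin n → ℝ) → ℝ)
    (x : Fin n → ℝ) : ℝ :=
  sSup { a : ℝ | ∃ R : Set (Fin n → ℝ), IsDyadicCube n R ∧ R ⊆ J ∧ x ∈ R ∧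
    a = ((volume R).toReal)⁻¹ * ∫ y in R, φ y }


lemma young_aux {p a b : ℝ} (hp : 1 < p) (ha : 0 ≤ a) (hb : 0 ≤ b) :
    p * (a * b ^ (p - 1)) ≤ a ^ p + (p - 1) * b ^ p := by
  have hpq : p.HolderConjugate (p / (p - 1)) := Real.HolderConjugate.conjExponent hp
  have h := Real.young_inequality_of_nonneg ha (Real.rpow_nonneg hb (p - 1)) hpq
  have hp1 : p - 1 ≠ 0 := by linarith
  rw [← Real.rpow_mul hb, mul_div_cancel₀ _ hp1] at h
  have hp0 : 0 < p := by linarith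
  have := mul_le_mul_of_nonneg_left h hp0.le
  have e : p * (a ^ p / p + b ^ p / (p / (p - 1))) = a ^ p + (p - 1) * b ^ p := by
    field_simp
  linarith

section abstract_part
variable {Ω : Type*} [MeasurableSpace Ω] (μ : Measure Ω)

def cellAvg {ι : Type*} (π : Ω → ι) (φ : Ω → ℝ) (x : Ω) : ℝ :=
  (μ.real (π ⁻¹' {π x}))⁻¹ * ∫ y in π ⁻¹' {π x}, φ y ∂μ

lemma cellAvg_bdd {ι : Type*} [Finite ι] (π : Ω → ι) (φ : Ω → ℝ) :
    ∃ C, ∀ x, |cellAvg μ π φ x| ≤ C := by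
  have := (Set.finite_range (fun j : ι =>
    |(μ.real (π ⁻¹' {j}))⁻¹ * ∫ y in π ⁻¹' {j}, φ y ∂μ|)).bddAbove
  obtain ⟨C, hC⟩ := this
  exact ⟨C, fun x => hC ⟨π x, rfl⟩⟩

lemma cellAvg_meas {ι : Type*} [Finite ι] [MeasurableSpace ι] [MeasurableSingletonClass ι]
    (π : Ω → ι) (hπ : Measurable π) (φ : Ω → ℝ) : Measurable (cellAvg μ π φ) := by
  have : Measurable (fun j : ι => (μ.real (π ⁻¹' {j}))⁻¹ * ∫ y in π ⁻¹' {j}, φ y ∂μ) :=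
    measurable_of_finite _
  exact this.comp hπ

lemma cellAvg_nonneg {ι : Type*} (π : Ω → ι) (φ : Ω → ℝ) (h : ∀ x, 0 ≤ φ x) (x : Ω) :
    0 ≤ cellAvg μ π φ x :=
  mul_nonneg (inv_nonneg.2 measureReal_nonneg) (integral_nonneg h)

lemma integral_cells {ι : Type*} [Fintype ι] [MeasurableSpace ι] [MeasurableSingletonClass ι]
    (π : Ω → ι) (hπ : Measurable π) (g : Ω → ℝ) (hg : Integrable g μ) :
    ∫ x, g x ∂μ = ∑ j : ι, ∫ x in π ⁻¹' {j}, g x ∂μ := by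
  rw [← integral_iUnion_fintype]
  · have : (⋃ j : ι, π ⁻¹' {j}) = univ := by ext x; simp
    rw [this, Measure.restrict_univ]
  · intro j; exact hπ (measurableSet_singleton j)
  · intro i j hij
    exact Disjoint.preimage _ (by simpa using hij)
  · intro i; exact hg.integrableOn

lemma tower {ι : Type*} [Finite ι] [MeasurableSpace ι] [MeasurableSingletonClass ι]
    [IsFiniteMeasure μ]
    (π : Ω → ι) (hπ : Measurable π) (φ h : Ω → ℝ)
    (hh : ∀ x y, π x = π y → h x = h y)
    (h1 : Integrable (fun x => cellAvg μ π φ x * h x) μ)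
    (h2 : Integrable (fun x => φ x * h x) μ) :
    ∫ x, cellAvg μ π φ x * h x ∂μ = ∫ x, φ x * h x ∂μ := by
  have := Fintype.ofFinite ι
  rw [integral_cells μ π hπ _ h1, integral_cells μ π hπ _ h2]
  refine Finset.sum_congr rfl fun j _ => ?_
  have hm : MeasurableSet (π ⁻¹' {j}) := hπ (measurableSet_singleton j)
  rcases (π ⁻¹' {j}).eq_empty_or_nonempty with he | ⟨x0, hx0⟩
  · simp [he]
  have hx0' : π x0 = j := hx0
  have e1 : ∫ x in π ⁻¹' {j}, cellAvg μ π φ x * h x ∂μ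
      = ∫ x in π ⁻¹' {j}, cellAvg μ π φ x0 * h x0 ∂μ := by
    refine setIntegral_congr_fun hm fun x hx => ?_
    have hx' : π x = j := hx
    have : π x = π x0 := hx'.trans hx0'.symm
    simp only [cellAvg, this, hh x x0 this]
  have e2 : ∫ x in π ⁻¹' {j}, φ x * h x ∂μ
      = ∫ x in π ⁻¹' {j}, φ x * h x0 ∂μ := by
    refine setIntegral_congr_fun hm fun x hx => ?_
    have hx' : π x = j := hx
    have : π x = π x0 := hx'.trans hx0'.symm
    simp only [hh x x0 this]
  rw [integral_mul_const] at e2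
  rw [e1, e2, setIntegral_const, cellAvg, hx0']
  by_cases h0 : μ.real (π ⁻¹' {j}) = 0
  · have : μ (π ⁻¹' {j}) = 0 := by
      rwa [measureReal_eq_zero_iff] at h0
    rw [h0, setIntegral_measure_zero _ this]; simp
  · rw [smul_eq_mul]; field_simp

variable {ι : ℕ → Type*}

def runMax (π : ∀ k, Ω → ι k) (φ : Ω → ℝ) : ℕ → Ω → ℝ
  | 0 => cellAvg μ (π 0) φ
  | k + 1 => fun x => max (runMax π φ k x) (cellAvg μ (π (k + 1)) φ x)

lemma le_runMax (π : ∀ k, Ω → ι k) (φ : Ω → ℝ) (k : ℕ) (x : Ω) :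
    cellAvg μ (π k) φ x ≤ runMax μ π φ k x := by
  cases k with
  | zero => exact le_rfl
  | succ k => exact le_max_right _ _

lemma runMax_nonneg (π : ∀ k, Ω → ι k) (φ : Ω → ℝ) (h : ∀ x, 0 ≤ φ x) (k : ℕ) (x : Ω) :
    0 ≤ runMax μ π φ k x :=
  (cellAvg_nonneg μ _ φ h x).trans (le_runMax μ π φ k x)

lemma runMax_mono (π : ∀ k, Ω → ι k) (φ : Ω → ℝ) (x : Ω) :
    Monotone (fun k => runMax μ π φ k x) :=
  monotone_nat_of_le_succ fun _ => le_max_left _ _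

lemma runMax_bdd [∀ k, Finite (ι k)] (π : ∀ k, Ω → ι k) (φ : Ω → ℝ) (k : ℕ) :
    ∃ C, ∀ x, |runMax μ π φ k x| ≤ C := by
  induction k with
  | zero => exact cellAvg_bdd μ _ _
  | succ k ih =>
    obtain ⟨C, hC⟩ := ih
    obtain ⟨D, hD⟩ := cellAvg_bdd μ (π (k + 1)) φ
    refine ⟨max C D, fun x => ?_⟩
    exact abs_max_le_max_abs_abs.trans (max_le_max (hC x) (hD x))

lemma runMax_const (π : ∀ k, Ω → ι k) (φ : Ω → ℝ)
    (href : ∀ k x y, π (k + 1) x = π (k + 1) y → π k x = π k y) (k : ℕ) :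
    ∀ x y, π k x = π k y → runMax μ π φ k x = runMax μ π φ k y := by
  induction k with
  | zero => intro x y h; simp only [runMax, cellAvg, h]
  | succ k ih =>
    intro x y h
    simp only [runMax, cellAvg, h, ih x y (href k x y h)]

lemma runMax_meas [∀ k, Finite (ι k)] [∀ k, MeasurableSpace (ι k)]
    [∀ k, MeasurableSingletonClass (ι k)]
    (π : ∀ k, Ω → ι k) (hπ : ∀ k, Measurable (π k)) (φ : Ω → ℝ) (k : ℕ) :
    Measurable (runMax μ π φ k) := by
  induction k with
  | zero => exact cellAvg_meas μ _ (hπ 0) _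
  | succ k ih => exact ih.max (cellAvg_meas μ _ (hπ (k + 1)) _)

lemma step_ineq {p a b : ℝ} (hp : 1 < p) (ha : 0 ≤ a) (hb : 0 ≤ b) :
    (p - 1) * ((max a b) ^ p - a ^ p) ≤ p * (b * ((max a b) ^ (p - 1) - a ^ (p - 1))) := by
  rcases le_total b a with h | h
  · simp [max_eq_left h]
  · rw [max_eq_right h]
    have := young_aux hp hb ha
    have e : b * b ^ (p - 1) = b ^ p := by
      rcases hb.eq_or_lt with rfl | hb
      · rw [Real.zero_rpow (by linarith : p ≠ 0)]; simp
      · rw [Real.rpow_sub_one hb.ne']; field_simp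
    rw [mul_sub, mul_sub, mul_sub, e]
    linarith

lemma rpow_bdd_int [IsFiniteMeasure μ] {g φ : Ω → ℝ} (hg : Measurable g) (hg0 : ∀ x, 0 ≤ g x)
    {C : ℝ} (hC : ∀ x, |g x| ≤ C) {s : ℝ} (hs : 0 ≤ s) (hφ : Integrable φ μ) :
    Integrable (fun x => φ x * g x ^ s) μ := by
  refine hφ.mul_bdd (c := C ^ s) (hg.pow_const s).aestronglyMeasurable ?_
  refine Eventually.of_forall fun x => ?_
  rw [Real.norm_eq_abs, abs_of_nonneg (Real.rpow_nonneg (hg0 x) _)]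
  exact Real.rpow_le_rpow (hg0 x) ((le_abs_self _).trans (hC x)) hs

lemma runMax_ineq [IsProbabilityMeasure μ] [∀ k, Finite (ι k)] [∀ k, MeasurableSpace (ι k)]
    [∀ k, MeasurableSingletonClass (ι k)]
    (π : ∀ k, Ω → ι k) (hπ : ∀ k, Measurable (π k)) (φ : Ω → ℝ) (h0 : ∀ x, 0 ≤ φ x)
    (hφ : Integrable φ μ)
    (href : ∀ k x y, π (k + 1) x = π (k + 1) y → π k x = π k y)
    (hsub : ∀ x y, π 0 x = π 0 y) {p : ℝ} (hp : 1 < p) (k : ℕ) :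
    (p - 1) * ∫ x, runMax μ π φ k x ^ p ∂μ ≤
      - (∫ x, φ x ∂μ) ^ p + p * ∫ x, φ x * runMax μ π φ k x ^ (p - 1) ∂μ := by
  have hf0 : 0 ≤ ∫ x, φ x ∂μ := integral_nonneg h0
  have hm := runMax_meas μ π hπ φ
  have hnn := runMax_nonneg μ π φ h0
  have hI : ∀ k, ∀ s : ℝ, 0 ≤ s → Integrable (fun x => runMax μ π φ k x ^ s) μ := by
    intro k s hs
    obtain ⟨C, hC⟩ := runMax_bdd μ π φ k
    simpa using rpow_bdd_int μ (hm k) (hnn k) hC hs (integrable_const (1 : ℝ))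
  have hJ : ∀ k, ∀ s : ℝ, 0 ≤ s → ∀ ψ : Ω → ℝ, Integrable ψ μ →
      Integrable (fun x => ψ x * runMax μ π φ k x ^ s) μ := by
    intro k s hs ψ hψ
    obtain ⟨C, hC⟩ := runMax_bdd μ π φ k
    exact rpow_bdd_int μ (hm k) (hnn k) hC hs hψ
  have hA : ∀ k, Integrable (cellAvg μ (π k) φ) μ := by
    intro k
    obtain ⟨C, hC⟩ := cellAvg_bdd μ (π k) φ
    exact Integrable.of_bound (cellAvg_meas μ _ (hπ k) φ).aestronglyMeasurable C
      (Eventually.of_forall hC)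
  induction k with
  | zero =>
    have e : ∀ x, runMax μ π φ 0 x = ∫ x, φ x ∂μ := by
      intro x
      have : π 0 ⁻¹' {π 0 x} = univ := by ext y; simp [hsub y x]
      simp [runMax, cellAvg, this]
    simp only [e, integral_const, integral_mul_const]
    set f := ∫ x, φ x ∂μ
    have e : f * f ^ (p - 1) = f ^ p := by
      rcases hf0.eq_or_lt with hb | hb
      · rw [← hb, Real.zero_rpow (by linarith : p ≠ 0)]; simp
      · rw [Real.rpow_sub_one hb.ne']; field_simp
    rw [e]; simp; linarith
  | succ k ih =>
    have hp1 : 0 ≤ p - 1 := by linarith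
    have hp0 : 0 ≤ p := by linarith
    have key : ∫ x, (p - 1) * (runMax μ π φ (k+1) x ^ p - runMax μ π φ k x ^ p) ∂μ ≤
        ∫ x, p * (cellAvg μ (π (k+1)) φ x *
          (runMax μ π φ (k+1) x ^ (p-1) - runMax μ π φ k x ^ (p-1))) ∂μ := by
      refine integral_mono (((hI _ p hp0).sub (hI _ p hp0)).const_mul _) ?_ ?_
      · refine Integrable.const_mul ?_ _
        simp only [mul_sub]
        exact (hJ _ _ hp1 _ (hA _)).sub (hJ _ _ hp1 _ (hA _))
      · intro x
        exact step_ineq hp (hnn k x) (cellAvg_nonneg μ _ φ h0 x)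
    rw [integral_const_mul, integral_const_mul, integral_sub (hI _ p hp0) (hI _ p hp0),
      tower μ (π (k+1)) (hπ (k+1)) φ] at key
    · simp only [mul_sub] at key
      rw [integral_sub (hJ _ _ hp1 _ hφ) (hJ _ _ hp1 _ hφ)] at key
      linarith
    · intro x y h
      rw [runMax_const μ π φ href (k+1) x y h, runMax_const μ π φ href k x y (href k x y h)]
    · simp only [mul_sub]
      exact (hJ _ _ hp1 _ (hA _)).sub (hJ _ _ hp1 _ (hA _))
    · simp only [mul_sub]
      exact (hJ _ _ hp1 _ hφ).sub (hJ _ _ hp1 _ hφ)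

lemma runMax_bound [IsProbabilityMeasure μ] [∀ k, Finite (ι k)] [∀ k, MeasurableSpace (ι k)]
    [∀ k, MeasurableSingletonClass (ι k)]
    (π : ∀ k, Ω → ι k) (hπ : ∀ k, Measurable (π k)) (φ : Ω → ℝ) (h0 : ∀ x, 0 ≤ φ x)
    (hφ : Integrable φ μ)
    (href : ∀ k x y, π (k + 1) x = π (k + 1) y → π k x = π k y)
    (hsub : ∀ x y, π 0 x = π 0 y) {p : ℝ} (hp : 1 < p)
    (hφp : Integrable (fun x => φ x ^ p) μ) {f F z : ℝ} (hF : 0 < F)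
    (hf : ∫ x, φ x ∂μ = f) (hFe : ∫ x, φ x ^ p ∂μ = F) (hz : 1 ≤ z)
    (hzeq : -(p - 1) * z ^ p + p * z ^ (p - 1) = f ^ p / F) (k : ℕ) :
    ∫ x, runMax μ π φ k x ^ p ∂μ ≤ F * z ^ p := by
  have main := runMax_ineq μ π hπ φ h0 hφ href hsub hp k
  have hp0 : 0 ≤ p := by linarith
  have hp1 : 0 ≤ p - 1 := by linarith
  obtain ⟨C, hC⟩ := runMax_bdd μ π φ k
  have hnn := runMax_nonneg μ π φ h0 k
  have hI : Integrable (fun x => runMax μ π φ k x ^ p) μ := by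
    simpa using rpow_bdd_int μ (runMax_meas μ π hπ φ k) hnn hC hp0 (integrable_const (1 : ℝ))
  have hJ : Integrable (fun x => φ x * runMax μ π φ k x ^ (p - 1)) μ :=
    rpow_bdd_int μ (runMax_meas μ π hπ φ k) hnn hC hp1 hφ
  rw [hf] at main
  set I := ∫ x, runMax μ π φ k x ^ p ∂μ
  -- weighted Young, integrated
  have hY : ∀ t : ℝ, 0 < t → p * (t * ∫ x, φ x * runMax μ π φ k x ^ (p - 1) ∂μ) ≤
      t ^ p * F + (p - 1) * I := by
    intro t ht
    have : ∫ x, p * (t * (φ x * runMax μ π φ k x ^ (p - 1))) ∂μ ≤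
        ∫ x, t ^ p * φ x ^ p + (p - 1) * runMax μ π φ k x ^ p ∂μ := by
      refine integral_mono ((hJ.const_mul t).const_mul p)
        ((hφp.const_mul _).add (hI.const_mul _)) fun x => ?_
      have := young_aux hp (mul_nonneg ht.le (h0 x)) (hnn x)
      rw [Real.mul_rpow ht.le (h0 x)] at this
      simp only
      linarith
    rwa [integral_add (hφp.const_mul _) (hI.const_mul _), integral_const_mul, integral_const_mul,
      integral_const_mul, integral_const_mul, hFe] at this
  have hfp : f ^ p = F * (-(p - 1) * z ^ p + p * z ^ (p - 1)) := by
    rw [hzeq]; field_simp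
  have hpow : ∀ t : ℝ, 0 < t → t ^ p = t * t ^ (p - 1) := by
    intro t ht
    rw [Real.rpow_sub_one ht.ne']; field_simp
  have gen : ∀ t : ℝ, 1 < t → f ^ p ≥ F * (-(p - 1) * t ^ p + p * t ^ (p - 1)) →
      I ≤ F * t ^ p := by
    intro t ht hft
    have ht0 : 0 < t := by linarith
    have h1 := hY t ht0
    have h2 := mul_le_mul_of_nonneg_left main ht0.le
    have h3 := mul_le_mul_of_nonneg_left hft ht0.le
    have h4 := hpow t ht0
    have h5 : ((p - 1) * (t - 1)) * I ≤ ((p - 1) * (t - 1)) * (F * t ^ p) := by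
      have : t * (F * (-(p - 1) * t ^ p + p * t ^ (p - 1)))
          = -(p - 1) * t * F * t ^ p + p * F * t ^ p := by rw [h4]; ring
      nlinarith
    exact le_of_mul_le_mul_left h5 (mul_pos (by linarith) (by linarith))
  rcases hz.eq_or_lt with h | h
  · subst h
    have hfF : f ^ p = F := by rw [hfp]; simp
    have hc : ContinuousAt (fun t : ℝ => F * t ^ p) 1 :=
      continuousAt_const.mul (Real.continuousAt_rpow_const 1 p (Or.inl one_ne_zero))
    have ht : Tendsto (fun t : ℝ => F * t ^ p) (nhdsWithin 1 (Ioi 1)) (nhds (F * 1 ^ p)) :=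
      hc.tendsto.mono_left nhdsWithin_le_nhds
    refine ge_of_tendsto ht ?_
    filter_upwards [self_mem_nhdsWithin] with t ht
    have ht1 : (1 : ℝ) < t := ht
    refine gen t ht1 ?_
    rw [hfF]
    have := young_aux hp zero_le_one (by linarith : 0 ≤ t)
    rw [Real.one_rpow] at this
    nlinarith
  · exact gen z h hfp.ge

end abstract_part

section concrete_part

/-- Index of the dyadic cube of generation `k` containing a point. -/
def cubeIdx (n k : ℕ) (x : Fin n → ℝ) : Fin n → Fin (2 ^ k) :=
  fun i => Fin.ofNat (2 ^ k) ⌊2 ^ k * x i⌋₊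

lemma cubeIdx_meas (n k : ℕ) : Measurable (cubeIdx n k) := by
  refine measurable_pi_lambda _ fun i => ?_
  have h1 : Measurable (fun m : ℕ => Fin.ofNat (2 ^ k) m) := measurable_from_nat
  exact h1.comp (Nat.measurable_floor.comp ((measurable_pi_apply i).const_mul _))

lemma cubeIdx_eq_iff (n k : ℕ) (x y : Fin n → ℝ) :
    cubeIdx n k x = cubeIdx n k y ↔
      ∀ i, ⌊2 ^ k * x i⌋₊ % 2 ^ k = ⌊2 ^ k * y i⌋₊ % 2 ^ k := by
  simp [cubeIdx, funext_iff, Fin.ext_iff]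

lemma cubeIdx_ref (n k : ℕ) (x y : Fin n → ℝ)
    (h : cubeIdx n (k + 1) x = cubeIdx n (k + 1) y) : cubeIdx n k x = cubeIdx n k y := by
  rw [cubeIdx_eq_iff] at h ⊢
  intro i
  have e : ∀ t : ℝ, ⌊2 ^ k * t⌋₊ = ⌊2 ^ (k + 1) * t⌋₊ / 2 := by
    intro t
    rw [← Nat.floor_div_ofNat]
    congr 1
    rw [pow_succ]
    ring
  have e2 : ∀ m : ℕ, m / 2 % 2 ^ k = (m % 2 ^ (k + 1)) / 2 := by
    intro m
    rw [pow_succ, mul_comm, Nat.mod_mul_right_div_self]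
  rw [e, e, e2, e2, h i]

lemma floor_lt_of_mem {n : ℕ} (k : ℕ) {x : Fin n → ℝ} (hx : x ∈ unitCube n) (i : Fin n) :
    ⌊2 ^ k * x i⌋₊ < 2 ^ k := by
  have h := hx i (mem_univ i)
  rw [Nat.floor_lt (mul_nonneg (by positivity) h.1)]
  push_cast
  have : (0 : ℝ) < 2 ^ k := by positivity
  nlinarith [h.2]

lemma cube_eq {n : ℕ} {R : Set (Fin n → ℝ)} (hR : IsDyadicCube n R) {x : Fin n → ℝ}
    (hx : x ∈ R) : ∃ N, R = cubeIdx n N ⁻¹' {cubeIdx n N x} ∩ unitCube n := by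
  obtain ⟨N, k, hk, rfl⟩ := hR
  have h2 : (0 : ℝ) < 2 ^ N := by positivity
  have char : ∀ y : Fin n → ℝ, y ∈ (Set.univ.pi fun i =>
      Set.Ico ((k i : ℝ) / 2 ^ N) (((k i : ℝ) + 1) / 2 ^ N)) ↔
      y ∈ unitCube n ∧ ∀ i, ⌊2 ^ N * y i⌋₊ = k i := by
    intro y
    constructor
    · intro hy
      have key : ∀ i, (k i : ℝ) ≤ 2 ^ N * y i ∧ 2 ^ N * y i < k i + 1 := by
        intro i
        have := hy i (mem_univ i)
        rw [mem_Ico, div_le_iff₀' h2, lt_div_iff₀' h2] at this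
        exact this
      refine ⟨fun i _ => ⟨?_, ?_⟩, fun i => ?_⟩
      · have := (key i).1
        have h0 : (0 : ℝ) ≤ k i := by positivity
        exact nonneg_of_mul_nonneg_right (h0.trans this) h2
      · have h3 : (k i : ℝ) + 1 ≤ 2 ^ N := by exact_mod_cast hk i
        have := (key i).2
        by_contra hc
        push Not at hc
        nlinarith
      · have h0 : (0 : ℝ) ≤ k i := by positivity
        rw [Nat.floor_eq_iff (h0.trans (key i).1)]
        exact key i
    · rintro ⟨hy, hf⟩ i -
      have h0 : 0 ≤ 2 ^ N * y i := mul_nonneg h2.le (hy i (mem_univ i)).1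
      have := (Nat.floor_eq_iff h0).1 (hf i)
      rw [mem_Ico, div_le_iff₀' h2, lt_div_iff₀' h2]
      exact this
  refine ⟨N, ?_⟩
  have hx' := (char x).1 hx
  ext y
  rw [char]
  simp only [mem_inter_iff, mem_preimage, mem_singleton_iff, cubeIdx_eq_iff]
  constructor
  · rintro ⟨hy, hf⟩
    exact ⟨fun i => by rw [hf i, hx'.2 i], hy⟩
  · rintro ⟨hf, hy⟩
    refine ⟨hy, fun i => ?_⟩
    have := hf i
    rwa [Nat.mod_eq_of_lt (floor_lt_of_mem N hy i), Nat.mod_eq_of_lt (floor_lt_of_mem N hx'.1 i),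
      hx'.2 i] at this

lemma unitCube_meas (n : ℕ) : MeasurableSet (unitCube n) :=
  MeasurableSet.univ_pi fun _ => measurableSet_Ico

lemma unitCube_vol (n : ℕ) : volume (unitCube n) = 1 := by
  rw [unitCube, volume_pi_pi]; simp

lemma dyadicMax_le {n : ℕ} (φ : (Fin n → ℝ) → ℝ) (h0 : ∀ x, 0 ≤ φ x) (x : Fin n → ℝ) {p : ℝ}
    (hp : 1 < p) :
    ENNReal.ofReal (dyadicMax n φ x ^ p) ≤
      ⨆ k, ENNReal.ofReal
        (runMax (volume.restrict (unitCube n)) (cubeIdx n) φ k x ^ p) := by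
  set μ := volume.restrict (unitCube n) with hμ
  set S := ⨆ k, ENNReal.ofReal (runMax μ (cubeIdx n) φ k x ^ p) with hS
  have hp0 : 0 < p := by linarith
  by_cases hT : S = ⊤
  · rw [hT]; exact le_top
  have hle : ∀ k, runMax μ (cubeIdx n) φ k x ≤ S.toReal ^ (1 / p) := by
    intro k
    have h1 : ENNReal.ofReal (runMax μ (cubeIdx n) φ k x ^ p) ≤ S :=
      le_iSup (fun k => ENNReal.ofReal (runMax μ (cubeIdx n) φ k x ^ p)) k
    have h2 := (ENNReal.ofReal_le_iff_le_toReal hT).1 h1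
    rw [one_div]
    exact (Real.le_rpow_inv_iff_of_pos (runMax_nonneg μ _ φ h0 k x) ENNReal.toReal_nonneg hp0).2 h2
  have hM : dyadicMax n φ x ≤ S.toReal ^ (1 / p) := by
    refine Real.sSup_le ?_ (Real.rpow_nonneg ENNReal.toReal_nonneg _)
    rintro a ⟨R, hR, hx, rfl⟩
    obtain ⟨N, hN⟩ := cube_eq hR hx
    refine le_trans (le_of_eq ?_) ((le_runMax μ (cubeIdx n) φ N x).trans (hle N))
    have hm : MeasurableSet (cubeIdx n N ⁻¹' {cubeIdx n N x}) :=
      cubeIdx_meas n N (measurableSet_singleton _)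
    rw [cellAvg, hμ, Measure.restrict_restrict hm, ← hN, measureReal_restrict_apply hm, ← hN]
    rfl
  have hM0 : 0 ≤ dyadicMax n φ x := by
    refine Real.sSup_nonneg ?_
    rintro a ⟨R, hR, hx, rfl⟩
    exact mul_nonneg (by positivity) (integral_nonneg h0)
  rw [ENNReal.ofReal_le_iff_le_toReal hT]
  rw [one_div] at hM
  exact (Real.le_rpow_inv_iff_of_pos hM0 ENNReal.toReal_nonneg hp0).1 hM

end concrete_part

/-- Upper-bound half of the Bellman function computation. -/
theorem dyadicMax_bellman_upper (n : ℕ) (hn : 1 ≤ n) (p f F z : ℝ) (hp : 1 < p)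
    (hf : 0 < f ^ p) (hfF : f ^ p ≤ F)
    (hz : z ∈ Set.Icc 1 (p / (p - 1)))
    (hzeq : -(p - 1) * z ^ p + p * z ^ (p - 1) = f ^ p / F)
    (φ : (Fin n → ℝ) → ℝ) (hφ0 : ∀ x, 0 ≤ φ x) (hφm : Measurable φ)
    (hint1 : ∫ x in unitCube n, φ x = f)
    (hintp : ∫ x in unitCube n, φ x ^ p = F) :
    ∫ x in unitCube n, (dyadicMax n φ x) ^ p ≤ F * z ^ p := by
  have hF : 0 < F := lt_of_lt_of_le hf hfF
  set μ := volume.restrict (unitCube n) with hμ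
  have : IsProbabilityMeasure μ := ⟨by rw [hμ, Measure.restrict_apply_univ, unitCube_vol]⟩
  have hp0 : 0 < p := by linarith
  have hφi : Integrable φ μ := by
    by_contra hc
    rw [integral_undef hc] at hint1
    rw [← hint1, Real.zero_rpow hp0.ne'] at hf
    exact lt_irrefl _ hf
  have hφpi : Integrable (fun x => φ x ^ p) μ := by
    by_contra hc
    rw [integral_undef hc] at hintp
    exact hF.ne hintp
  have hnn := runMax_nonneg μ (cubeIdx n) φ hφ0
  have hmeas := runMax_meas μ (cubeIdx n) (cubeIdx_meas n) φ
  have bound := runMax_bound μ (cubeIdx n) (cubeIdx_meas n) φ hφ0 hφi (cubeIdx_ref n)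
    (fun x y => by rw [cubeIdx_eq_iff]; intro i; simp [Nat.mod_one]) hp hφpi hF hint1 hintp hz.1 hzeq
  have hR0 : 0 ≤ F * z ^ p := mul_nonneg hF.le (Real.rpow_nonneg (by linarith [hz.1]) _)
  by_cases hMi : Integrable (fun x => dyadicMax n φ x ^ p) μ
  swap
  · rw [integral_undef hMi]; exact hR0
  have hM0 : ∀ x, 0 ≤ dyadicMax n φ x := by
    intro x
    refine Real.sSup_nonneg ?_
    rintro a ⟨R, hR, hx, rfl⟩
    exact mul_nonneg (by positivity) (integral_nonneg hφ0)
  rw [← ENNReal.ofReal_le_ofReal_iff hR0, ofReal_integral_eq_lintegral_ofReal hMi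
    (Eventually.of_forall fun x => Real.rpow_nonneg (hM0 x) p)]
  calc ∫⁻ x, ENNReal.ofReal (dyadicMax n φ x ^ p) ∂μ
      ≤ ∫⁻ x, ⨆ k, ENNReal.ofReal (runMax μ (cubeIdx n) φ k x ^ p) ∂μ :=
        lintegral_mono fun x => dyadicMax_le φ hφ0 x hp
    _ = ⨆ k, ∫⁻ x, ENNReal.ofReal (runMax μ (cubeIdx n) φ k x ^ p) ∂μ := by
        refine lintegral_iSup (fun k => ((hmeas k).pow_const p).ennreal_ofReal) ?_
        intro i j hij x
        exact ENNReal.ofReal_le_ofReal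
          (Real.rpow_le_rpow (hnn i x) (runMax_mono μ (cubeIdx n) φ x hij) hp0.le)
    _ ≤ ENNReal.ofReal (F * z ^ p) := by
        refine iSup_le fun k => ?_
        have hI : Integrable (fun x => runMax μ (cubeIdx n) φ k x ^ p) μ := by
          obtain ⟨C, hC⟩ := runMax_bdd μ (cubeIdx n) φ k
          simpa using rpow_bdd_int μ (hmeas k) (hnn k) hC hp0.le (integrable_const (1 : ℝ))
        rw [← ofReal_integral_eq_lintegral_ofReal hI
          (Eventually.of_forall fun x => Real.rpow_nonneg (hnn k x) p)]
        exact ENNReal.ofReal_le_ofReal (bound k)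
end
end

section
/- Let n ≥ 1, let Q = [0,1)^n with Lebesgue measure, let p > 1, let f, F be reals with 0 < f^p ≤ F, and let z ∈ [1, p/(p-1)] satisfy -(p-1)z^p + p z^{p-1} = f^p/F. Let (φ_m)_{m∈ℕ} be a sequence of nonnegative measurable functions on Q with ∫_Q φ_m = f and ∫_Q φ_m^p = F for every m, and with lim_{m→∞} ∫_Q (Mφ_m)^p = F·z^p. Then for every dyadic subcube I of Q, lim_{m→∞} (1/|I|) ∫_I φ_m^p = F. -/
open MeasureTheory Set Filter

noncomputable section

namespace DyEx

/-- Index of the level `k` dyadic cube containing `x`. -/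
def idx {n : ℕ} (k : ℕ) (x : Fin n → ℝ) : Fin n → ℤ := fun i => ⌊(2:ℝ) ^ k * x i⌋

/-- The level `k` dyadic cube containing `x`. -/
def cube {n : ℕ} (k : ℕ) (x : Fin n → ℝ) : Set (Fin n → ℝ) := {y | idx k y = idx k x}

/-- Level `k` cube with given index. -/
def cub {n : ℕ} (k : ℕ) (J : Fin n → Fin (2 ^ k)) : Set (Fin n → ℝ) :=
  {y | idx k y = fun i => ((J i : ℕ) : ℤ)}

def pt {n : ℕ} (k : ℕ) (J : Fin n → Fin (2 ^ k)) : Fin n → ℝ := fun i => ((J i : ℕ) : ℝ) / 2 ^ k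

/-- Functions constant on the level `k` cubes. -/
def Step {n : ℕ} (k : ℕ) (g : (Fin n → ℝ) → ℝ) : Prop := ∀ x y, idx k x = idx k y → g x = g y

lemma idx_meas {n : ℕ} (k : ℕ) : Measurable (idx k : (Fin n → ℝ) → _) := by
  unfold idx
  fun_prop

lemma mem_cube {n k : ℕ} (x : Fin n → ℝ) : x ∈ cube k x := rfl

lemma cube_eq_of_idx {n k : ℕ} {x y : Fin n → ℝ} (h : idx k x = idx k y) : cube k x = cube k y := by
  unfold cube; rw [h]

lemma cube_eq {n : ℕ} (k : ℕ) (x : Fin n → ℝ) : cube k x =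
    Set.univ.pi fun i => Set.Ico ((idx k x i : ℝ) / 2 ^ k) (((idx k x i : ℝ) + 1) / 2 ^ k) := by
  ext y
  have h2 : (0:ℝ) < 2 ^ k := by positivity
  simp only [cube, mem_ofPred_eq, Set.mem_pi, mem_univ, true_imp_iff, mem_Ico, div_le_iff₀ h2,
    lt_div_iff₀ h2]
  rw [funext_iff]
  refine forall_congr' fun i => ?_
  rw [show idx k y i = ⌊(2:ℝ) ^ k * y i⌋ from rfl, Int.floor_eq_iff, mul_comm]

lemma vol_cube {n : ℕ} (k : ℕ) (x : Fin n → ℝ) :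
    (volume (cube k x)).toReal = (1 / 2 ^ k) ^ n := by
  rw [cube_eq, Real.volume_pi_Ico_toReal]
  · simp [← sub_div]
  · intro i; dsimp only; gcongr; linarith

lemma vol_pos {n : ℕ} (k : ℕ) (x : Fin n → ℝ) : 0 < (volume (cube k x)).toReal := by
  rw [vol_cube]; positivity

lemma vol_ne_top {n : ℕ} (k : ℕ) (x : Fin n → ℝ) : volume (cube k x) ≠ ⊤ := by
  intro h
  have := vol_pos k x
  simp [h] at this

lemma cube_meas {n : ℕ} (k : ℕ) (x : Fin n → ℝ) : MeasurableSet (cube k x) :=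
  (idx_meas k) (measurableSet_singleton _)

lemma cub_meas {n : ℕ} (k : ℕ) (J : Fin n → Fin (2 ^ k)) : MeasurableSet (cub k J) :=
  (idx_meas k) (measurableSet_singleton _)

lemma idx_pt {n : ℕ} (k : ℕ) (J : Fin n → Fin (2 ^ k)) :
    idx k (pt k J) = fun i => ((J i : ℕ) : ℤ) := by
  funext i
  have h2 : (2:ℝ) ^ k ≠ 0 := by positivity
  simp only [idx, pt]
  rw [mul_div_cancel₀ _ h2]
  simp

lemma cub_eq_cube {n : ℕ} (k : ℕ) (J : Fin n → Fin (2 ^ k)) : cub k J = cube k (pt k J) := by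
  unfold cub cube; rw [idx_pt]

lemma mem_Q_iff {n : ℕ} (k : ℕ) (x : Fin n → ℝ) :
    x ∈ unitCube n ↔ ∀ i, 0 ≤ idx k x i ∧ idx k x i < 2 ^ k := by
  have h2 : (0:ℝ) < 2 ^ k := by positivity
  simp only [unitCube, Set.mem_pi, mem_univ, true_imp_iff, mem_Ico]
  refine forall_congr' fun i => ?_
  simp only [idx]
  rw [Int.le_floor, Int.floor_lt]
  push_cast
  rw [mul_nonneg_iff_of_pos_left h2, mul_lt_iff_lt_one_right h2]

lemma Q_meas (n : ℕ) : MeasurableSet (unitCube n) :=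
  MeasurableSet.univ_pi fun _ => measurableSet_Ico

lemma Q_cover {n : ℕ} (k : ℕ) : unitCube n = ⋃ J : Fin n → Fin (2 ^ k), cub k J := by
  ext x
  rw [mem_Q_iff k, mem_iUnion]
  constructor
  · intro h
    refine ⟨fun i => ⟨(idx k x i).toNat, ?_⟩, ?_⟩
    · have := (h i).2
      have h0 := (h i).1
      zify
      rw [Int.toNat_of_nonneg h0]
      exact this
    · funext i
      simp [Int.toNat_of_nonneg (h i).1]
  · rintro ⟨J, hJ⟩ i
    have : idx k x i = ((J i : ℕ) : ℤ) := congrFun hJ i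
    rw [this]
    refine ⟨by positivity, ?_⟩
    have := (J i).2
    exact_mod_cast this

lemma cub_disj {n : ℕ} (k : ℕ) :
    Pairwise (Function.onFun Disjoint (fun J : Fin n → Fin (2 ^ k) => cub k J)) := by
  intro J J' hne
  refine Set.disjoint_left.2 fun x hx hx' => hne ?_
  funext i
  have h1 : idx k x i = ((J i : ℕ) : ℤ) := congrFun hx i
  have h2 : idx k x i = ((J' i : ℕ) : ℤ) := congrFun hx' i
  rw [h1] at h2
  exact Fin.ext (by exact_mod_cast h2)

lemma cube_sub_Q {n : ℕ} (k : ℕ) {x : Fin n → ℝ} (hx : x ∈ unitCube n) :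
    cube k x ⊆ unitCube n := by
  intro y hy
  rw [mem_Q_iff k] at hx ⊢
  have : idx k y = idx k x := hy
  rwa [this]

lemma cube_zero {n : ℕ} {x : Fin n → ℝ} (hx : x ∈ unitCube n) : cube 0 x = unitCube n := by
  refine (cube_sub_Q 0 hx).antisymm ?_
  intro y hy
  rw [mem_Q_iff 0] at hx hy
  show idx 0 y = idx 0 x
  funext i
  have := hx i; have := hy i
  simp at *
  omega

lemma vol_Q (n : ℕ) : (volume (unitCube n)).toReal = 1 := by
  have h0 : (0 : Fin n → ℝ) ∈ unitCube n := by simp [unitCube]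
  rw [← cube_zero h0, vol_cube]; simp

lemma vol_Q_ne_top (n : ℕ) : volume (unitCube n) ≠ ⊤ := by
  have h0 : (0 : Fin n → ℝ) ∈ unitCube n := by simp [unitCube]
  rw [← cube_zero h0]; exact vol_ne_top _ _

lemma idx_succ {n : ℕ} (k : ℕ) {x y : Fin n → ℝ} (h : idx (k + 1) x = idx (k + 1) y) :
    idx k x = idx k y := by
  have key : ∀ (x : Fin n → ℝ) i, idx k x i = idx (k + 1) x i / 2 := by
    intro x i
    simp only [idx]
    have := Int.floor_div_natCast ((2:ℝ) ^ (k + 1) * x i) 2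
    push_cast at this
    rw [← this]
    congr 1
    rw [pow_succ]; ring
  funext i
  rw [key, key, h]

lemma idx_mono {n : ℕ} {j k : ℕ} (hjk : j ≤ k) {x y : Fin n → ℝ} (h : idx k x = idx k y) :
    idx j x = idx j y := by
  induction k, hjk using Nat.le_induction with
  | base => exact h
  | succ k _ ih => exact ih (idx_succ k h)

lemma Step.mono {n j k : ℕ} (hjk : j ≤ k) {g : (Fin n → ℝ) → ℝ} (h : Step j g) : Step k g :=
  fun x y hxy => h x y (idx_mono hjk hxy)

lemma dyadic_iff {n : ℕ} (R : Set (Fin n → ℝ)) :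
    IsDyadicCube n R ↔ ∃ k x, x ∈ unitCube n ∧ R = cube k x := by
  constructor
  · rintro ⟨N, k, hk, rfl⟩
    refine ⟨N, pt N (fun i => ⟨k i, hk i⟩), ?_, ?_⟩
    · rw [Q_cover N, mem_iUnion]
      exact ⟨_, idx_pt _ _⟩
    · rw [cube_eq, idx_pt]
      simp
  · rintro ⟨k, x, hx, rfl⟩
    rw [mem_Q_iff k] at hx
    refine ⟨k, fun i => (idx k x i).toNat, ?_, ?_⟩
    · intro i
      zify
      rw [Int.toNat_of_nonneg (hx i).1]
      exact (hx i).2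
    · rw [cube_eq]
      congr 1
      funext i
      have : (((idx k x i).toNat : ℕ) : ℝ) = (idx k x i : ℝ) := by
        have := Int.toNat_of_nonneg (hx i).1
        exact_mod_cast this
      rw [this]

/-- averages -/
def av {n : ℕ} (φ : (Fin n → ℝ) → ℝ) (k : ℕ) (x : Fin n → ℝ) : ℝ :=
  ((volume (cube k x)).toReal)⁻¹ * ∫ y in cube k x, φ y

/-- truncated maximal function -/
def mx {n : ℕ} (φ : (Fin n → ℝ) → ℝ) (k : ℕ) (x : Fin n → ℝ) : ℝ :=
  partialSups (fun j => av φ j x) k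

lemma max_eq {n : ℕ} (φ : (Fin n → ℝ) → ℝ) {x : Fin n → ℝ} (hx : x ∈ unitCube n) :
    dyadicMax n φ x = ⨆ k, av φ k x := by
  unfold dyadicMax iSup
  congr 1
  ext a
  simp only [mem_ofPred_eq, mem_range]
  constructor
  · rintro ⟨R, hR, hxR, rfl⟩
    obtain ⟨k, y, hy, rfl⟩ := (dyadic_iff R).1 hR
    refine ⟨k, ?_⟩
    have : cube k x = cube k y := cube_eq_of_idx hxR
    simp [av, this]
  · rintro ⟨k, rfl⟩
    exact ⟨cube k x, (dyadic_iff _).2 ⟨k, x, hx, rfl⟩, mem_cube x, rfl⟩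

lemma step_av {n : ℕ} (φ : (Fin n → ℝ) → ℝ) (k : ℕ) : Step k (av φ k) := by
  intro x y h
  unfold av; rw [cube_eq_of_idx h]

lemma mx_zero {n : ℕ} (φ : (Fin n → ℝ) → ℝ) (x : Fin n → ℝ) : mx φ 0 x = av φ 0 x := by
  simp [mx]

lemma mx_succ {n : ℕ} (φ : (Fin n → ℝ) → ℝ) (k : ℕ) (x : Fin n → ℝ) :
    mx φ (k + 1) x = max (mx φ k x) (av φ (k + 1) x) := by
  simp only [mx]; rw [partialSups_add_one]

lemma mx_mono {n : ℕ} (φ : (Fin n → ℝ) → ℝ) (x : Fin n → ℝ) : Monotone (fun k => mx φ k x) :=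
  (partialSups (fun j => av φ j x)).monotone

lemma av_le_mx {n : ℕ} (φ : (Fin n → ℝ) → ℝ) (k : ℕ) (x : Fin n → ℝ) : av φ k x ≤ mx φ k x :=
  le_partialSups (fun j => av φ j x) k

lemma step_mx {n : ℕ} (φ : (Fin n → ℝ) → ℝ) (k : ℕ) : Step k (mx φ k) := by
  induction k with
  | zero => intro x y h; rw [mx_zero, mx_zero]; exact step_av φ 0 x y h
  | succ k ih =>
    intro x y h
    rw [mx_succ, mx_succ, step_av φ (k+1) x y h, ih x y (idx_succ k h)]

lemma Step.eqOn {n k : ℕ} {g : (Fin n → ℝ) → ℝ} (h : Step k g) (x : Fin n → ℝ) :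
    EqOn g (fun _ => g x) (cube k x) := fun y hy => h y x hy

lemma step_mul_int {n k : ℕ} {g φ : (Fin n → ℝ) → ℝ} (h : Step k g)
    (hφ : IntegrableOn φ (unitCube n)) : IntegrableOn (fun x => g x * φ x) (unitCube n) := by
  rw [Q_cover k] at hφ ⊢
  rw [integrableOn_finite_iUnion] at hφ ⊢
  intro J
  have := hφ J
  rw [cub_eq_cube] at this ⊢
  refine IntegrableOn.congr_fun (f := fun x => g (pt k J) * φ x) (this.const_mul _) ?_ (cube_meas _ _)
  intro y hy
  simp only
  rw [h.eqOn _ hy]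

lemma one_int (n : ℕ) : IntegrableOn (fun _ : Fin n → ℝ => (1:ℝ)) (unitCube n) :=
  integrableOn_const (vol_Q_ne_top n)

lemma step_int {n k : ℕ} {g : (Fin n → ℝ) → ℝ} (h : Step k g) : IntegrableOn g (unitCube n) := by
  simpa using step_mul_int h (one_int n)

lemma step_mul_integral {n k : ℕ} {g φ : (Fin n → ℝ) → ℝ} (h : Step k g)
    (hφ : IntegrableOn φ (unitCube n)) : ∫ x in unitCube n, g x * φ x =
      ∑ J : Fin n → Fin (2 ^ k), g (pt k J) * ∫ x in cube k (pt k J), φ x := by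
  have := step_mul_int h hφ
  rw [Q_cover k] at this ⊢
  rw [integral_iUnion_fintype (cub_meas k) (cub_disj k) (integrableOn_finite_iUnion.1 this)]
  refine Finset.sum_congr rfl fun J _ => ?_
  rw [cub_eq_cube, ← integral_const_mul]
  refine setIntegral_congr_fun (cube_meas _ _) fun y hy => ?_
  rw [h.eqOn _ hy]

lemma step_integral {n k : ℕ} {g : (Fin n → ℝ) → ℝ} (h : Step k g) : ∫ x in unitCube n, g x =
      ∑ J : Fin n → Fin (2 ^ k), g (pt k J) * (volume (cube k (pt k J))).toReal := by
  have := step_mul_integral h (one_int n)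
  simpa [Measure.real] using this

lemma step_avg {n k : ℕ} {g φ : (Fin n → ℝ) → ℝ} (h : Step k g)
    (hφ : IntegrableOn φ (unitCube n)) :
    ∫ x in unitCube n, g x * av φ k x = ∫ x in unitCube n, g x * φ x := by
  have hs : Step k (fun x => g x * av φ k x) := fun x y hxy => by
    simp only
    rw [h x y hxy, step_av φ k x y hxy]
  rw [step_mul_integral h hφ, step_integral hs]
  refine Finset.sum_congr rfl fun J _ => ?_
  have := (vol_pos k (pt k J)).ne'
  simp only [av]
  field_simp

lemma pt_mem {n k : ℕ} (J : Fin n → Fin (2 ^ k)) : pt k J ∈ unitCube n := by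
  rw [Q_cover k, mem_iUnion]
  exact ⟨J, idx_pt _ _⟩

lemma step_tendsto {n k : ℕ} {g : ℕ → (Fin n → ℝ) → ℝ} {g₀ : (Fin n → ℝ) → ℝ}
    (h : ∀ m, Step k (g m)) (h₀ : Step k g₀)
    (hl : ∀ x ∈ unitCube n, Tendsto (fun m => g m x) atTop (nhds (g₀ x))) :
    Tendsto (fun m => ∫ x in unitCube n, g m x) atTop (nhds (∫ x in unitCube n, g₀ x)) := by
  simp_rw [fun m => step_integral (h m), step_integral h₀]
  exact tendsto_finsetSum _ fun J _ => (hl _ (pt_mem J)).mul_const _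

lemma step_le {n k : ℕ} {g : (Fin n → ℝ) → ℝ} (h : Step k g) (h0 : ∀ x ∈ unitCube n, 0 ≤ g x)
    {x : Fin n → ℝ} (hx : x ∈ unitCube n) :
    g x ≤ ((volume (cube k x)).toReal)⁻¹ * ∫ y in unitCube n, g y := by
  have : ∫ y in cube k x, g y ≤ ∫ y in unitCube n, g y := by
    refine setIntegral_mono_set (step_int h) ?_ (cube_sub_Q k hx).eventuallyLE
    exact (ae_restrict_iff' (Q_meas n)).2 (Eventually.of_forall h0)
  rw [setIntegral_congr_fun (cube_meas _ _) (h.eqOn x), setIntegral_const] at this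
  have hv := vol_pos k x
  simp only [Measure.real, smul_eq_mul] at this
  rw [inv_mul_eq_div, le_div_iff₀ hv]
  linarith

lemma step_zero {n k : ℕ} {g : ℕ → (Fin n → ℝ) → ℝ}
    (h : ∀ m, Step k (g m)) (h0 : ∀ m, ∀ x ∈ unitCube n, 0 ≤ g m x)
    (hl : Tendsto (fun m => ∫ x in unitCube n, g m x) atTop (nhds 0))
    {x : Fin n → ℝ} (hx : x ∈ unitCube n) : Tendsto (fun m => g m x) atTop (nhds 0) := by
  refine squeeze_zero (fun m => h0 m x hx) (fun m => step_le (h m) (h0 m) hx) ?_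
  simpa using hl.const_mul ((volume (cube k x)).toReal)⁻¹

lemma Step.measurable {n k : ℕ} {g : (Fin n → ℝ) → ℝ} (h : Step k g) : Measurable g := by
  have : g = (fun j : Fin n → ℤ => g (fun i => (j i : ℝ) / 2 ^ k)) ∘ idx k := by
    funext x
    refine h _ _ ?_
    funext i
    have h2 : (2:ℝ) ^ k ≠ 0 := by positivity
    conv_rhs => rw [idx]
    rw [mul_div_cancel₀ _ h2, Int.floor_intCast]
  rw [this]
  exact (measurable_of_countable _).comp (idx_meas k)

end DyEx

namespace DyEx

def yy (p a b : ℝ) : ℝ := (p - 1) * a ^ p + b ^ p - p * a ^ (p - 1) * b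

lemma pm {p a : ℝ} (hp : 1 < p) (ha : 0 ≤ a) : a ^ (p - 1) * a = a ^ p := by
  have h := Real.rpow_add_one' ha (y := p - 1) (by linarith)
  rw [← h]; congr 1; ring

lemma yy_pos {p a b : ℝ} (hp : 1 < p) (ha : 0 ≤ a) (hb : 0 ≤ b) (hab : a ≠ b) : 0 < yy p a b := by
  unfold yy
  rcases ha.eq_or_lt with rfl | ha'
  · have hb' : 0 < b := lt_of_le_of_ne hb hab
    rw [Real.zero_rpow (by linarith), Real.zero_rpow (by linarith)]
    have := Real.rpow_pos_of_pos hb' p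
    linarith
  · have h := one_add_mul_self_lt_rpow_one_add (s := b / a - 1) (by have := div_nonneg hb ha; linarith)
      (by intro h; apply hab; field_simp at h; linarith) hp
    rw [show 1 + (b / a - 1) = b / a by ring, Real.div_rpow hb ha] at h
    have hap := Real.rpow_pos_of_pos ha' p
    rw [lt_div_iff₀ hap] at h
    have e : a ^ (p - 1) = a ^ p / a := by
      rw [← pm hp ha]; field_simp
    rw [e]
    have : (1 + p * (b / a - 1)) * a ^ p = a ^ p + p * (a ^ p / a) * b - p * a ^ p := by
      field_simp; ring
    nlinarith

lemma yy_self {p a : ℝ} (hp : 1 < p) (ha : 0 ≤ a) : yy p a a = 0 := by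
  unfold yy
  rw [mul_assoc, pm hp ha]; ring

lemma yy_nonneg {p a b : ℝ} (hp : 1 < p) (ha : 0 ≤ a) (hb : 0 ≤ b) : 0 ≤ yy p a b := by
  by_cases h : a = b
  · rw [← h, yy_self hp ha]
  · exact (yy_pos hp ha hb h).le

lemma yy_tendsto {p C : ℝ} (hp : 1 < p) {a b : ℕ → ℝ} (ha : ∀ m, a m ∈ Icc 0 C)
    (hb : ∀ m, b m ∈ Icc 0 C) (h : Tendsto (fun m => yy p (a m) (b m)) atTop (nhds 0))
    {g : ℝ → ℝ} (hg : Continuous g) :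
    Tendsto (fun m => g (a m) - g (b m)) atTop (nhds 0) := by
  refine tendsto_of_subseq_tendsto fun ns hns => ?_
  have hK : IsCompact (Icc (0:ℝ) C ×ˢ Icc (0:ℝ) C) := isCompact_Icc.prod isCompact_Icc
  obtain ⟨⟨a0, b0⟩, ⟨ha0, hb0⟩, θ, hθ, hlim⟩ :=
    hK.tendsto_subseq (x := fun m => (a (ns m), b (ns m))) (fun m => ⟨ha _, hb _⟩)
  refine ⟨θ, ?_⟩
  have h1 : Tendsto (fun m => a (ns (θ m))) atTop (nhds a0) :=
    (continuous_fst.tendsto _).comp hlim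
  have h2 : Tendsto (fun m => b (ns (θ m))) atTop (nhds b0) :=
    (continuous_snd.tendsto _).comp hlim
  have h3 : Tendsto (fun m => yy p (a (ns (θ m))) (b (ns (θ m)))) atTop (nhds (yy p a0 b0)) := by
    unfold yy
    have e1 := h1.rpow_const (p := p) (Or.inr (by linarith))
    have e2 := h2.rpow_const (p := p) (Or.inr (by linarith))
    have e3 := h1.rpow_const (p := p - 1) (Or.inr (by linarith))
    exact ((e1.const_mul _).add e2).sub ((e3.const_mul p).mul h2)
  have h4 : Tendsto (fun m => yy p (a (ns (θ m))) (b (ns (θ m)))) atTop (nhds 0) :=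
    h.comp (hns.comp hθ.tendsto_atTop)
  have h5 := tendsto_nhds_unique h3 h4
  have h6 : a0 = b0 := by
    by_contra hne
    exact (yy_pos hp ha0.1 hb0.1 hne).ne' h5
  have := ((hg.tendsto _).comp h1).sub ((hg.tendsto _).comp h2)
  rwa [h6, sub_self] at this

/-- the supermartingale -/
def UU {n : ℕ} (p : ℝ) (φ : (Fin n → ℝ) → ℝ) (k : ℕ) (x : Fin n → ℝ) : ℝ :=
  mx φ k x ^ p - p / (p - 1) * (mx φ k x ^ (p - 1) * av φ k x)

lemma av_nonneg {n : ℕ} {φ : (Fin n → ℝ) → ℝ} (h0 : ∀ x, 0 ≤ φ x) (k : ℕ) (x : Fin n → ℝ) :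
    0 ≤ av φ k x :=
  mul_nonneg (by positivity) (integral_nonneg h0)

lemma mx_nonneg {n : ℕ} {φ : (Fin n → ℝ) → ℝ} (h0 : ∀ x, 0 ≤ φ x) (k : ℕ) (x : Fin n → ℝ) :
    0 ≤ mx φ k x := (av_nonneg h0 k x).trans (av_le_mx φ k x)

lemma UU_succ {n : ℕ} {p : ℝ} (hp : 1 < p) {φ : (Fin n → ℝ) → ℝ} (h0 : ∀ x, 0 ≤ φ x) (k : ℕ)
    (x : Fin n → ℝ) : UU p φ (k + 1) x = UU p φ k x
      - p / (p - 1) * (mx φ k x ^ (p - 1) * av φ (k + 1) x - mx φ k x ^ (p - 1) * av φ k x)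
      - 1 / (p - 1) * yy p (mx φ k x) (mx φ (k + 1) x) := by
  have hp1 : p - 1 ≠ 0 := by linarith
  have hm := mx_nonneg h0 k x
  have ha := av_nonneg h0 (k + 1) x
  simp only [UU, mx_succ]
  rcases le_total (av φ (k + 1) x) (mx φ k x) with h | h
  · rw [max_eq_left h, yy_self hp hm]; ring
  · rw [max_eq_right h, yy, pm hp ha]
    field_simp
    ring

lemma step_UU {n : ℕ} (p : ℝ) (φ : (Fin n → ℝ) → ℝ) (k : ℕ) : Step k (UU p φ k) := fun x y h => by
  simp only [UU]; rw [step_mx φ k x y h, step_av φ k x y h]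

lemma step_yy {n : ℕ} (p : ℝ) (φ : (Fin n → ℝ) → ℝ) (k : ℕ) :
    Step (k + 1) (fun x => yy p (mx φ k x) (mx φ (k + 1) x)) := fun x y h => by
  simp only
  rw [step_mx φ k x y (idx_succ k h), step_mx φ _ x y h]

lemma Step.mul {n k : ℕ} {g h : (Fin n → ℝ) → ℝ} (hg : Step k g) (hh : Step k h) :
    Step k (fun x => g x * h x) := fun x y e => by
  simp only
  rw [hg x y e, hh x y e]

lemma Step.rpow {n k : ℕ} {g : (Fin n → ℝ) → ℝ} (hg : Step k g) (p : ℝ) :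
    Step k (fun x => g x ^ p) := fun x y e => by
  simp only
  rw [hg x y e]

lemma UU_int_succ {n : ℕ} {p : ℝ} (hp : 1 < p) {φ : (Fin n → ℝ) → ℝ} (h0 : ∀ x, 0 ≤ φ x)
    (hφ : IntegrableOn φ (unitCube n)) {k : ℕ} {w : (Fin n → ℝ) → ℝ} (hw : Step k w) :
    ∫ x in unitCube n, w x * UU p φ (k + 1) x = (∫ x in unitCube n, w x * UU p φ k x)
      - 1 / (p - 1) * ∫ x in unitCube n, w x * yy p (mx φ k x) (mx φ (k + 1) x) := by
  have hw' : Step (k + 1) w := hw.mono (Nat.le_succ k)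
  have hg : Step k (fun x => w x * mx φ k x ^ (p - 1)) := hw.mul ((step_mx φ k).rpow _)
  have hg' := hg.mono (Nat.le_succ k)
  have i1 := step_int (hw.mul (step_UU p φ k))
  have i2 := step_int (hg'.mul (step_av φ (k + 1)))
  have i3 := step_int (hg.mul (step_av φ k))
  have i4 := step_int (hw'.mul (step_yy p φ k))
  have e : ∀ x, w x * UU p φ (k + 1) x = w x * UU p φ k x
      - p / (p - 1) * (w x * mx φ k x ^ (p - 1) * av φ (k + 1) x
        - w x * mx φ k x ^ (p - 1) * av φ k x)
      - 1 / (p - 1) * (w x * yy p (mx φ k x) (mx φ (k + 1) x)) := by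
    intro x; rw [UU_succ hp h0]; ring
  simp_rw [e]
  have i23 : IntegrableOn (fun x => p / (p - 1) * (w x * mx φ k x ^ (p - 1) * av φ (k + 1) x
        - w x * mx φ k x ^ (p - 1) * av φ k x)) (unitCube n) := (i2.sub i3).const_mul _
  have i123 : IntegrableOn (fun x => w x * UU p φ k x - p / (p - 1) *
      (w x * mx φ k x ^ (p - 1) * av φ (k + 1) x
        - w x * mx φ k x ^ (p - 1) * av φ k x)) (unitCube n) := i1.sub i23
  rw [integral_sub i123 (i4.const_mul _), integral_sub i1 i23, integral_const_mul, integral_const_mul,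
    integral_sub i2 i3, step_avg hg hφ, step_avg hg' hφ]
  simp

lemma UU_int_le {n : ℕ} {p : ℝ} (hp : 1 < p) {φ : (Fin n → ℝ) → ℝ} (h0 : ∀ x, 0 ≤ φ x)
    (hφ : IntegrableOn φ (unitCube n)) {N k : ℕ} (hNk : N ≤ k) {w : (Fin n → ℝ) → ℝ}
    (hw : Step N w) (hw0 : ∀ x, 0 ≤ w x) :
    ∫ x in unitCube n, w x * UU p φ k x ≤ ∫ x in unitCube n, w x * UU p φ N x := by
  induction k, hNk using Nat.le_induction with
  | base => exact le_rfl
  | succ k hk ih =>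
    rw [UU_int_succ hp h0 hφ (hw.mono hk)]
    have h1 : 0 ≤ ∫ x in unitCube n, w x * yy p (mx φ k x) (mx φ (k + 1) x) :=
      integral_nonneg fun x => mul_nonneg (hw0 x)
        (yy_nonneg hp (mx_nonneg h0 _ _) (mx_nonneg h0 _ _))
    have h2 : 0 < 1 / (p - 1) := by apply one_div_pos.2; linarith
    have := mul_nonneg h2.le h1
    linarith

/-- Sets that are unions of level `N` cubes. -/
def SS {n : ℕ} (N : ℕ) (E : Set (Fin n → ℝ)) : Prop := Step N (E.indicator fun _ => (1:ℝ))

lemma SS.meas {n N : ℕ} {E : Set (Fin n → ℝ)} (h : SS N E) : MeasurableSet E :=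
  (measurable_indicator_const_iff (1:ℝ)).1 (Step.measurable h)

lemma set_eq {n N : ℕ} {E : Set (Fin n → ℝ)} (h : SS N E) (g : (Fin n → ℝ) → ℝ) :
    ∫ x in unitCube n, (E.indicator (fun _ => (1:ℝ)) x) * g x = ∫ x in unitCube n ∩ E, g x := by
  rw [← setIntegral_indicator h.meas]
  congr 1
  funext x
  by_cases hx : x ∈ E <;> simp [hx]

/-- Hoelder at level `k`. -/
lemma holder_k {n : ℕ} {p : ℝ} (hp : 1 < p) {φ : (Fin n → ℝ) → ℝ} (h0 : ∀ x, 0 ≤ φ x)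
    (hm : Measurable φ) (hφp : IntegrableOn (fun x => φ x ^ p) (unitCube n)) (k : ℕ)
    (E : Set (Fin n → ℝ)) :
    ∫ x in unitCube n ∩ E, mx φ k x ^ (p - 1) * φ x ≤
      (∫ x in unitCube n ∩ E, mx φ k x ^ p) ^ ((p - 1) / p) *
      (∫ x in unitCube n ∩ E, φ x ^ p) ^ (1 / p) := by
  have hpq : (p / (p - 1)).HolderConjugate p := (Real.HolderConjugate.conjExponent hp).symm
  have hp1 : p - 1 ≠ 0 := by linarith
  have key : ∀ x, (mx φ k x ^ (p - 1)) ^ (p / (p - 1)) = mx φ k x ^ p := by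
    intro x
    rw [← Real.rpow_mul (mx_nonneg h0 k x)]; congr 1; field_simp
  have hh := integral_mul_le_Lp_mul_Lq_of_nonneg (μ := volume.restrict (unitCube n ∩ E)) hpq
    (f := fun x => mx φ k x ^ (p - 1)) (g := φ)
    (Eventually.of_forall fun x => Real.rpow_nonneg (mx_nonneg h0 k x) _)
    (Eventually.of_forall h0) ?_ ?_
  · simp_rw [key] at hh
    rwa [one_div_div] at hh
  · have hq : 0 < p / (p - 1) := div_pos (by linarith) (by linarith)
    rw [← integrable_norm_rpow_iff]
    · have : IntegrableOn (fun x => mx φ k x ^ p) (unitCube n ∩ E) :=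
        (step_int ((step_mx φ k).rpow p)).mono_set inter_subset_left
      rw [ENNReal.toReal_ofReal hq.le]
      refine this.congr (Eventually.of_forall fun x => ?_)
      simp only
      rw [Real.norm_of_nonneg (Real.rpow_nonneg (mx_nonneg h0 k x) _), key]
    · exact ((step_mx φ k).rpow (p-1)).measurable.aestronglyMeasurable
    · simpa using hq
    · simp
  · rw [← integrable_norm_rpow_iff]
    · rw [ENNReal.toReal_ofReal (by linarith)]
      refine (hφp.mono_set inter_subset_left).congr (Eventually.of_forall fun x => ?_)
      simp only
      rw [Real.norm_of_nonneg (h0 x)]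
    · exact hm.aestronglyMeasurable
    · simp; linarith
    · simp

lemma main_k {n : ℕ} {p : ℝ} (hp : 1 < p) {φ : (Fin n → ℝ) → ℝ} (h0 : ∀ x, 0 ≤ φ x)
    (hm : Measurable φ) (hφ : IntegrableOn φ (unitCube n))
    (hφp : IntegrableOn (fun x => φ x ^ p) (unitCube n)) {N k : ℕ} (hNk : N ≤ k)
    {E : Set (Fin n → ℝ)} (hE : SS N E) :
    ∫ x in unitCube n ∩ E, mx φ k x ^ p ≤
      p / (p - 1) * ((∫ x in unitCube n ∩ E, mx φ k x ^ p) ^ ((p - 1) / p) *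
      (∫ x in unitCube n ∩ E, φ x ^ p) ^ (1 / p)) + ∫ x in unitCube n ∩ E, UU p φ N x := by
  have h1 := UU_int_le (p := p) hp h0 hφ hNk hE (fun x => indicator_nonneg (fun _ _ => zero_le_one) x)
  rw [set_eq hE (UU p φ N)] at h1
  set w := E.indicator (fun _ => (1:ℝ)) with hw
  have hwk : Step k w := Step.mono hNk hE
  have hg : Step k (fun x => w x * mx φ k x ^ (p - 1)) := hwk.mul ((step_mx φ k).rpow _)
  have i1 := step_int (hwk.mul ((step_mx φ k).rpow p))
  have i3 := step_int (hg.mul (step_av φ k))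
  have e : ∀ x, w x * UU p φ k x = w x * mx φ k x ^ p
      - p / (p - 1) * (w x * mx φ k x ^ (p - 1) * av φ k x) := by
    intro x; unfold UU; ring
  simp_rw [e] at h1
  rw [integral_sub i1 (i3.const_mul _), integral_const_mul, step_avg hg hφ] at h1
  simp only [mul_assoc] at h1
  rw [hw, set_eq hE, set_eq hE] at h1
  have h2 := holder_k hp h0 hm hφp k E
  have h3 : 0 < p / (p - 1) := div_pos (by linarith) (by linarith)
  have := mul_le_mul_of_nonneg_left h2 h3.le
  linarith

end DyEx

namespace DyEx

lemma av_zero {n : ℕ} (φ : (Fin n → ℝ) → ℝ) {x : Fin n → ℝ} (hx : x ∈ unitCube n) :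
    av φ 0 x = ∫ y in unitCube n, φ y := by
  unfold av; rw [cube_zero hx, vol_Q]; simp

lemma UU_zero {n : ℕ} {p : ℝ} (hp : 1 < p) {φ : (Fin n → ℝ) → ℝ} (h0 : ∀ x, 0 ≤ φ x) :
    ∫ x in unitCube n, UU p φ 0 x = - (∫ y in unitCube n, φ y) ^ p / (p - 1) := by
  have hf : 0 ≤ ∫ y in unitCube n, φ y := integral_nonneg h0
  have hp1 : p - 1 ≠ 0 := by linarith
  have : EqOn (UU p φ 0) (fun _ => - (∫ y in unitCube n, φ y) ^ p / (p - 1)) (unitCube n) := by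
    intro x hx
    simp only [UU, mx_zero]
    rw [av_zero φ hx, pm hp hf]
    field_simp; ring
  rw [setIntegral_congr_fun (Q_meas n) this, setIntegral_const, Measure.real, vol_Q]
  simp

lemma SS_univ {n N : ℕ} : SS N (univ : Set (Fin n → ℝ)) := fun x y _ => by simp

lemma bound_k {n : ℕ} {p : ℝ} (hp : 1 < p) {φ : (Fin n → ℝ) → ℝ} (h0 : ∀ x, 0 ≤ φ x)
    (hm : Measurable φ) (hφ : IntegrableOn φ (unitCube n))
    (hφp : IntegrableOn (fun x => φ x ^ p) (unitCube n)) (k : ℕ) :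
    ∫ x in unitCube n, mx φ k x ^ p ≤
      (p / (p - 1) * (∫ x in unitCube n, φ x ^ p) ^ (1 / p)) ^ p := by
  have h := main_k hp h0 hm hφ hφp (Nat.zero_le k) SS_univ
  simp only [inter_univ] at h
  rw [UU_zero hp h0] at h
  have hf : 0 ≤ (∫ y in unitCube n, φ y) ^ p := Real.rpow_nonneg (integral_nonneg h0) _
  have hF : 0 ≤ ∫ x in unitCube n, φ x ^ p := integral_nonneg fun x => Real.rpow_nonneg (h0 x) _
  have ha : 0 ≤ ∫ x in unitCube n, mx φ k x ^ p :=
    integral_nonneg fun x => Real.rpow_nonneg (mx_nonneg h0 k x) _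
  set a := ∫ x in unitCube n, mx φ k x ^ p
  set F := ∫ x in unitCube n, φ x ^ p
  have hp1 : 0 < p - 1 := by linarith
  have hc : 0 ≤ p / (p - 1) * F ^ (1 / p) := by positivity
  rcases ha.eq_or_lt with h' | h'
  · rw [← h']; positivity
  · have h1 : a ≤ a ^ ((p - 1) / p) * (p / (p - 1) * F ^ (1 / p)) := by
      have : 0 ≤ (∫ y in unitCube n, φ y) ^ p / (p - 1) := by positivity
      rw [neg_div] at h
      linarith
    have h2 : a = a ^ ((p - 1) / p) * a ^ (1 / p) := by
      rw [← Real.rpow_add h', ← add_div, sub_add_cancel, div_self (by linarith), Real.rpow_one]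
    have h3 : a ^ (1 / p) ≤ p / (p - 1) * F ^ (1 / p) := by
      refine le_of_mul_le_mul_left ?_ (Real.rpow_pos_of_pos h' ((p - 1) / p))
      rw [← h2]; exact h1
    calc a = (a ^ (1 / p)) ^ p := by
          rw [← Real.rpow_mul ha, one_div_mul_cancel (by linarith), Real.rpow_one]
      _ ≤ _ := Real.rpow_le_rpow (by positivity) h3 (by linarith)

lemma lim_facts {n : ℕ} {p : ℝ} (hp : 1 < p) {φ : (Fin n → ℝ) → ℝ} (h0 : ∀ x, 0 ≤ φ x)
    (hm : Measurable φ) (hφ : IntegrableOn φ (unitCube n))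
    (hφp : IntegrableOn (fun x => φ x ^ p) (unitCube n)) :
    (∀ᵐ x ∂(volume.restrict (unitCube n)),
      Tendsto (fun k => mx φ k x ^ p) atTop (nhds (dyadicMax n φ x ^ p))) ∧
    IntegrableOn (fun x => dyadicMax n φ x ^ p) (unitCube n) := by
  have hp0 : 0 < p := by linarith
  set G : ℕ → (Fin n → ℝ) → ENNReal := fun k x => ENNReal.ofReal (mx φ k x ^ p) with hG
  have hGm : ∀ k, Measurable (G k) := fun k =>
    ((step_mx φ k).rpow p).measurable.ennreal_ofReal
  have hmono : ∀ x, Monotone fun k => mx φ k x ^ p := fun x i j hij =>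
    Real.rpow_le_rpow (mx_nonneg h0 i x) (mx_mono φ x hij) hp0.le
  have hGmono : Monotone G := fun i j hij x => ENNReal.ofReal_le_ofReal (hmono x hij)
  set C := (p / (p - 1) * (∫ x in unitCube n, φ x ^ p) ^ (1 / p)) ^ p
  have hfin : ∫⁻ x in unitCube n, ⨆ k, G k x < ⊤ := by
    rw [lintegral_iSup hGm hGmono]
    refine lt_of_le_of_lt (iSup_le fun k => ?_) (ENNReal.ofReal_lt_top (r := C))
    rw [← ofReal_integral_eq_lintegral_ofReal (step_int ((step_mx φ k).rpow p))
      (Eventually.of_forall fun x => Real.rpow_nonneg (mx_nonneg h0 k x) _)]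
    exact ENNReal.ofReal_le_ofReal (bound_k hp h0 hm hφ hφp k)
  have hae := ae_lt_top (Measurable.iSup hGm) hfin.ne
  have hT : ∀ᵐ x ∂(volume.restrict (unitCube n)),
      Tendsto (fun k => mx φ k x ^ p) atTop (nhds (dyadicMax n φ x ^ p)) := by
    filter_upwards [hae, ae_restrict_mem (Q_meas n)] with x hx hxQ
    have hb : BddAbove (range fun k => mx φ k x) := by
      refine ⟨((⨆ k, G k x).toReal) ^ (1 / p), ?_⟩
      rintro _ ⟨k, rfl⟩
      have h1 : mx φ k x ^ p ≤ (⨆ k, G k x).toReal := by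
        rw [← ENNReal.ofReal_le_iff_le_toReal hx.ne]
        exact le_iSup (fun k => G k x) k
      calc mx φ k x = (mx φ k x ^ p) ^ (1 / p) := by
            rw [← Real.rpow_mul (mx_nonneg h0 k x), mul_one_div_cancel hp0.ne', Real.rpow_one]
        _ ≤ _ := Real.rpow_le_rpow (Real.rpow_nonneg (mx_nonneg h0 k x) _) h1 (by positivity)
    have h2 := tendsto_atTop_ciSup (mx_mono φ x) hb
    have h3 : (⨆ k, mx φ k x) = dyadicMax n φ x := by
      rw [max_eq φ hxQ]
      exact ciSup_partialSups_eq (bddAbove_range_partialSups.1 hb)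
    rw [h3] at h2
    exact h2.rpow_const (Or.inr hp0.le)
  refine ⟨hT, ?_, ?_⟩
  · exact aestronglyMeasurable_of_tendsto_ae atTop
      (fun k => ((step_mx φ k).rpow p).measurable.aestronglyMeasurable) hT
  · refine lt_of_le_of_lt (lintegral_mono_ae ?_) hfin
    filter_upwards [hT] with x hx
    have h0' : 0 ≤ dyadicMax n φ x ^ p :=
      ge_of_tendsto' hx fun k => Real.rpow_nonneg (mx_nonneg h0 k x) _
    rw [Real.enorm_of_nonneg h0']
    refine le_of_tendsto' ((ENNReal.continuous_ofReal.tendsto _).comp hx) fun k => ?_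
    exact le_iSup (fun k => G k x) k

lemma main_lim {n : ℕ} {p : ℝ} (hp : 1 < p) {φ : (Fin n → ℝ) → ℝ} (h0 : ∀ x, 0 ≤ φ x)
    (hm : Measurable φ) (hφ : IntegrableOn φ (unitCube n))
    (hφp : IntegrableOn (fun x => φ x ^ p) (unitCube n)) {N : ℕ}
    {E : Set (Fin n → ℝ)} (hE : SS N E) :
    ∫ x in unitCube n ∩ E, dyadicMax n φ x ^ p ≤
      p / (p - 1) * ((∫ x in unitCube n ∩ E, dyadicMax n φ x ^ p) ^ ((p - 1) / p) *
      (∫ x in unitCube n ∩ E, φ x ^ p) ^ (1 / p)) + ∫ x in unitCube n ∩ E, UU p φ N x := by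
  obtain ⟨hT, hI⟩ := lim_facts hp h0 hm hφ hφp
  have hp0 : 0 < p := by linarith
  have hl : Tendsto (fun k => ∫ x in unitCube n ∩ E, mx φ k x ^ p) atTop
      (nhds (∫ x in unitCube n ∩ E, dyadicMax n φ x ^ p)) := by
    refine integral_tendsto_of_tendsto_of_monotone
      (fun k => (step_int ((step_mx φ k).rpow p)).mono_set inter_subset_left)
      (hI.mono_set inter_subset_left) ?_ (ae_restrict_of_ae_restrict_of_subset inter_subset_left hT)
    exact Eventually.of_forall fun x i j hij =>
      Real.rpow_le_rpow (mx_nonneg h0 i x) (mx_mono φ x hij) hp0.le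
  refine le_of_tendsto_of_tendsto hl
    (((hl.rpow_const (Or.inr (div_nonneg (by linarith) hp0.le))).mul_const _).const_mul _ |>.add_const _) ?_
  filter_upwards [eventually_ge_atTop N] with k hk
  exact main_k hp h0 hm hφ hφp hk hE

end DyEx

namespace DyEx

lemma numbers {p f F z e e' : ℝ} (hp : 1 < p) (hf : 0 < f ^ p) (hF : 0 < F) (hz : 1 ≤ z)
    (hzeq : -(p - 1) * z ^ p + p * z ^ (p - 1) = f ^ p / F) {a a' b b' u u' : ℕ → ℝ}
    (ha : ∀ m, 0 ≤ a m) (ha' : ∀ m, 0 ≤ a' m) (hb : ∀ m, 0 ≤ b m) (hb' : ∀ m, 0 ≤ b' m)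
    (haa : Tendsto (fun m => a m + a' m) atTop (nhds (F * z ^ p))) (hbb : ∀ m, b m + b' m = F)
    (hu : Tendsto u atTop (nhds (-f ^ p / (p - 1) * e)))
    (hu' : Tendsto u' atTop (nhds (-f ^ p / (p - 1) * e'))) (hee : e + e' = 1)
    (h : ∀ m, a m ≤ p / (p - 1) * (a m ^ ((p - 1) / p) * b m ^ (1 / p)) + u m)
    (h' : ∀ m, a' m ≤ p / (p - 1) * (a' m ^ ((p - 1) / p) * b' m ^ (1 / p)) + u' m) :
    Tendsto b atTop (nhds (F * e)) := by
  have hp0 : 0 < p := by linarith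
  have hp1 : 0 < p - 1 := by linarith
  have hz0 : 0 < z := by linarith
  have hzp := pm hp hz0.le
  have key : ∀ a b u : ℝ, 0 ≤ a → 0 ≤ b →
      a ≤ p / (p - 1) * (a ^ ((p - 1) / p) * b ^ (1 / p)) + u →
      yy p (a ^ (1 / p)) (z * b ^ (1 / p)) ≤
        (p - 1) * a + z ^ p * b - z * (p - 1) * (a - u) := by
    intro a b u ha hb h
    unfold yy
    rw [Real.mul_rpow hz0.le (by positivity), ← Real.rpow_mul ha, ← Real.rpow_mul hb,
      ← Real.rpow_mul ha, one_div_mul_cancel hp0.ne', Real.rpow_one, Real.rpow_one,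
      show 1 / p * (p - 1) = (p - 1) / p by ring]
    have h2 : (p - 1) * (a - u) ≤ p * (a ^ ((p - 1) / p) * b ^ (1 / p)) := by
      have := mul_le_mul_of_nonneg_left h hp1.le
      have e : (p - 1) * (p / (p - 1) * (a ^ ((p - 1) / p) * b ^ (1 / p)) + u) =
        p * (a ^ ((p - 1) / p) * b ^ (1 / p)) + (p - 1) * u := by field_simp
      rw [e] at this
      linarith
    have := mul_le_mul_of_nonneg_left h2 hz0.le
    linarith
  have hyn : ∀ a b : ℝ, 0 ≤ a → 0 ≤ b → 0 ≤ yy p (a ^ (1 / p)) (z * b ^ (1 / p)) := by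
    intro a b ha hb
    exact yy_nonneg hp (by positivity) (by positivity)
  have hsum : Tendsto (fun m => (p - 1) * (a m + a' m) + z ^ p * F
      - z * (p - 1) * (a m + a' m - (u m + u' m))) atTop (nhds 0) := by
    have := ((haa.const_mul (p - 1)).add_const (z ^ p * F)).sub
      ((haa.sub (hu.add hu')).const_mul (z * (p - 1)))
    convert this using 2
    have e1 : -f ^ p / (p - 1) * e + -f ^ p / (p - 1) * e' = -f ^ p / (p - 1) := by
      rw [← mul_add, hee, mul_one]
    have e2 : f ^ p = F * (-(p - 1) * z ^ p + p * z ^ (p - 1)) := by rw [hzeq]; field_simp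
    rw [e1, e2, ← hzp]
    field_simp
    ring
  have hr : Tendsto (fun m => (p - 1) * a m + z ^ p * b m - z * (p - 1) * (a m - u m)) atTop
      (nhds 0) := by
    refine squeeze_zero (fun m => (hyn _ _ (ha m) (hb m)).trans (key _ _ _ (ha m) (hb m) (h m)))
      (fun m => ?_) hsum
    have h3 := (hyn _ _ (ha' m) (hb' m)).trans (key _ _ _ (ha' m) (hb' m) (h' m))
    rw [← hbb m]
    linarith
  have hy : Tendsto (fun m => yy p (a m ^ (1 / p)) (z * b m ^ (1 / p))) atTop (nhds 0) :=
    squeeze_zero (fun m => hyn _ _ (ha m) (hb m)) (fun m => key _ _ _ (ha m) (hb m) (h m)) hr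
  obtain ⟨B, hB⟩ := haa.bddAbove_range
  have hB' : ∀ m, a m ≤ B := fun m => by
    have := hB ⟨m, rfl⟩
    have := ha' m
    simp only at *
    linarith
  have hB0 : 0 ≤ B := (ha 0).trans (hB' 0)
  have hab := yy_tendsto (C := B ^ (1 / p) + z * F ^ (1 / p)) hp
    (fun m => ⟨Real.rpow_nonneg (ha m) _, by
      have : a m ^ (1 / p) ≤ B ^ (1 / p) := Real.rpow_le_rpow (ha m) (hB' m) (by positivity)
      have : 0 ≤ z * F ^ (1 / p) := by positivity
      linarith⟩)
    (fun m => ⟨mul_nonneg hz0.le (Real.rpow_nonneg (hb m) _), by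
      have : b m ^ (1 / p) ≤ F ^ (1 / p) := Real.rpow_le_rpow (hb m)
        (by have := hbb m; have := hb' m; linarith) (by positivity)
      have : 0 ≤ B ^ (1 / p) := by positivity
      have : z * b m ^ (1 / p) ≤ z * F ^ (1 / p) := by gcongr
      linarith⟩) hy (g := fun t => t ^ p) (Real.continuous_rpow_const hp0.le)
  have hab' : Tendsto (fun m => a m - z ^ p * b m) atTop (nhds 0) := by
    refine hab.congr fun m => ?_
    rw [Real.mul_rpow hz0.le (Real.rpow_nonneg (hb m) _), ← Real.rpow_mul (ha m),
      ← Real.rpow_mul (hb m), one_div_mul_cancel hp0.ne', Real.rpow_one, Real.rpow_one]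
  have hfin := (((hr.sub (hab'.const_mul ((p - 1) * (1 - z)))).sub
    (hu.const_mul (z * (p - 1)))).const_mul (F / (z * f ^ p)))
  have hfz : z * f ^ p ≠ 0 := by positivity
  convert hfin using 1
  · funext m
    have e2 : f ^ p = F * (-(p - 1) * z ^ p + p * z ^ (p - 1)) := by rw [hzeq]; field_simp
    rw [div_mul_eq_mul_div, eq_div_iff hfz, e2, ← hzp]
    ring
  · congr 1
    have : f ^ p ≠ 0 := hf.ne'
    field_simp
    ring

lemma av_bound {n : ℕ} {φ : (Fin n → ℝ) → ℝ} (h0 : ∀ x, 0 ≤ φ x)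
    (hφ : IntegrableOn φ (unitCube n)) (k : ℕ) {x : Fin n → ℝ} (hx : x ∈ unitCube n) :
    av φ k x ≤ ((2:ℝ) ^ k) ^ n * ∫ y in unitCube n, φ y := by
  unfold av
  rw [vol_cube]
  have h1 : ∫ y in cube k x, φ y ≤ ∫ y in unitCube n, φ y :=
    setIntegral_mono_set hφ (Eventually.of_forall h0) (cube_sub_Q k hx).eventuallyLE
  have e : ((1 / (2:ℝ) ^ k) ^ n)⁻¹ = ((2:ℝ) ^ k) ^ n := by simp
  rw [e]
  gcongr

lemma mx_bound {n : ℕ} {φ : (Fin n → ℝ) → ℝ} (h0 : ∀ x, 0 ≤ φ x)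
    (hφ : IntegrableOn φ (unitCube n)) (k : ℕ) {x : Fin n → ℝ} (hx : x ∈ unitCube n) :
    mx φ k x ≤ ((2:ℝ) ^ k) ^ n * ∫ y in unitCube n, φ y := by
  refine partialSups_le _ _ _ fun j hj => (av_bound h0 hφ j hx).trans ?_
  have : 0 ≤ ∫ y in unitCube n, φ y := integral_nonneg h0
  gcongr
  norm_num

end DyEx

open DyEx
/-- Along any extremal sequence, the p-averages over every dyadic subcube tend to `F`. -/
theorem extremal_pavg_tendsto (n : ℕ) (hn : 1 ≤ n) (p f F z : ℝ) (hp : 1 < p)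
    (hf : 0 < f ^ p) (hfF : f ^ p ≤ F)
    (hz : z ∈ Set.Icc 1 (p / (p - 1)))
    (hzeq : -(p - 1) * z ^ p + p * z ^ (p - 1) = f ^ p / F)
    (φ : ℕ → (Fin n → ℝ) → ℝ)
    (hφ0 : ∀ m x, 0 ≤ φ m x) (hφm : ∀ m, Measurable (φ m))
    (h1 : ∀ m, ∫ x in unitCube n, φ m x = f)
    (h2 : ∀ m, ∫ x in unitCube n, φ m x ^ p = F)
    (h3 : Tendsto (fun m => ∫ x in unitCube n, (dyadicMax n (φ m) x) ^ p)
      atTop (nhds (F * z ^ p))) :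
    ∀ I : Set (Fin n → ℝ), IsDyadicCube n I →
      Tendsto (fun m => (1 / (volume I).toReal) * ∫ x in I, φ m x ^ p)
        atTop (nhds F) := by
  have hp0 : 0 < p := by linarith
  have hp1 : 0 < p - 1 := by linarith
  have hF : 0 < F := hf.trans_le hfF
  have hz1 : 1 ≤ z := hz.1
  have hz0 : 0 < z := by linarith
  have hf0 : 0 ≤ f := by rw [← h1 0]; exact integral_nonneg (hφ0 0)
  have hfne : f ≠ 0 := by
    rintro rfl
    rw [Real.zero_rpow hp0.ne'] at hf
    exact lt_irrefl _ hf
  have hI : ∀ m, IntegrableOn (φ m) (unitCube n) := fun m => by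
    by_contra hc
    exact hfne (by rw [← h1 m]; exact integral_undef hc)
  have hIp : ∀ m, IntegrableOn (fun x => φ m x ^ p) (unitCube n) := fun m => by
    by_contra hc
    exact hF.ne' (by rw [← h2 m]; exact integral_undef hc)
  have e2 : f ^ p = F * (-(p - 1) * z ^ p + p * z ^ (p - 1)) := by rw [hzeq]; field_simp
  -- deficits tend to zero
  have hyy : ∀ k, Tendsto (fun m => ∫ x in unitCube n, yy p (mx (φ m) k x) (mx (φ m) (k + 1) x))
      atTop (nhds 0) := by
    intro k
    have hb : Tendsto (fun m => (p - 1) * (p / (p - 1) *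
        ((∫ x in unitCube n, (dyadicMax n (φ m) x) ^ p) ^ ((p - 1) / p) * F ^ (1 / p))
        - ∫ x in unitCube n, (dyadicMax n (φ m) x) ^ p) - f ^ p) atTop (nhds 0) := by
      have := ((((h3.rpow_const (p := (p - 1) / p) (Or.inr (div_nonneg hp1.le hp0.le))).mul_const
        (F ^ (1 / p))).const_mul (p / (p - 1))).sub h3).const_mul (p - 1) |>.sub_const (f ^ p)
      convert this using 2
      have e3 : (F * z ^ p) ^ ((p - 1) / p) * F ^ (1 / p) = F * z ^ (p - 1) := by
        rw [Real.mul_rpow hF.le (by positivity), ← Real.rpow_mul hz0.le, mul_div_cancel₀ _ hp0.ne',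
          mul_right_comm, ← Real.rpow_add hF, ← add_div, sub_add_cancel, div_self hp0.ne',
          Real.rpow_one]
      rw [e3, e2]
      field_simp
      ring
    refine squeeze_zero (fun m => integral_nonneg fun x =>
      yy_nonneg hp (mx_nonneg (hφ0 m) _ _) (mx_nonneg (hφ0 m) _ _)) (fun m => ?_) hb
    have k1 := main_lim hp (hφ0 m) (hφm m) (hI m) (hIp m) (SS_univ (N := k + 1))
    simp only [inter_univ] at k1
    have k2 := UU_int_succ (w := fun _ => 1) (k := k) hp (hφ0 m) (hI m) (fun x y _ => rfl)
    have k3 := UU_int_le (w := fun _ => 1) hp (hφ0 m) (hI m) (Nat.zero_le k) (fun x y _ => rfl)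
      (fun _ => zero_le_one)
    simp only [one_mul] at k2 k3
    rw [UU_zero hp (hφ0 m), h1 m] at k3
    rw [h2 m] at k1
    have k4 : (p - 1) * ((∫ x in unitCube n, (dyadicMax n (φ m) x) ^ p) -
        (p / (p - 1) *
        ((∫ x in unitCube n, (dyadicMax n (φ m) x) ^ p) ^ ((p - 1) / p) * F ^ (1 / p)))) ≤
        (p - 1) * (-f ^ p / (p - 1) - 1 / (p - 1) *
          ∫ x in unitCube n, yy p (mx (φ m) k x) (mx (φ m) (k + 1) x)) := by
      refine mul_le_mul_of_nonneg_left ?_ hp1.le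
      linarith
    rw [mul_sub (p - 1) (-f ^ p / (p - 1)), mul_div_cancel₀ _ hp1.ne', ← mul_assoc (p - 1) (1 / (p - 1)),
      mul_one_div_cancel hp1.ne', one_mul] at k4
    linarith
  have hmx : ∀ k, ∀ x ∈ unitCube n, Tendsto (fun m => mx (φ m) k x) atTop (nhds f) := by
    intro k x hx
    induction k with
    | zero =>
      refine tendsto_const_nhds.congr fun m => ?_
      rw [mx_zero, av_zero _ hx, h1 m]
    | succ k ih =>
      have k1 := step_zero (fun m => step_yy p (φ m) k) (fun m x _ =>
        yy_nonneg hp (mx_nonneg (hφ0 m) _ _) (mx_nonneg (hφ0 m) _ _)) (hyy k) hx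
      have hbd : ∀ m, mx (φ m) (k + 1) x ≤ ((2:ℝ) ^ (k + 1)) ^ n * f := fun m => by
        rw [← h1 m]; exact mx_bound (hφ0 m) (hI m) (k + 1) hx
      have k2 := yy_tendsto hp
        (fun m => ⟨mx_nonneg (hφ0 m) k x, (mx_mono (φ m) x (Nat.le_succ k)).trans (hbd m)⟩)
        (fun m => ⟨mx_nonneg (hφ0 m) (k + 1) x, hbd m⟩) k1 continuous_id
      have k3 := ih.sub k2
      simpa using k3
  have hav : ∀ k, ∀ x ∈ unitCube n, Tendsto (fun m => av (φ m) k x) atTop (nhds f) := by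
    intro k x hx
    have k0 : Tendsto (fun m => ∫ x in unitCube n, mx (φ m) k x) atTop (nhds f) := by
      have := step_tendsto (fun m => step_mx (φ m) k) (g₀ := fun _ => f) (fun _ _ _ => rfl) (hmx k)
      simpa [Measure.real, vol_Q] using this
    have k1 : Tendsto (fun m => ∫ x in unitCube n, (mx (φ m) k x - av (φ m) k x)) atTop
        (nhds 0) := by
      have := k0.sub_const f
      rw [sub_self] at this
      refine this.congr fun m => ?_
      rw [integral_sub (step_int (step_mx _ k)) (step_int (step_av _ k))]
      have k2 := step_avg (k := k) (g := fun _ => 1) (fun _ _ _ => rfl) (hI m)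
      simp only [one_mul] at k2
      rw [k2, h1 m]
    have k3 := step_zero (k := k) (fun m x y h => by
      rw [step_mx (φ m) k x y h, step_av (φ m) k x y h])
      (fun m x _ => sub_nonneg.2 (av_le_mx (φ m) k x)) k1 hx
    have := (hmx k x hx).sub k3
    simpa using this
  have hUU : ∀ (N : ℕ) (E : Set (Fin n → ℝ)), SS N E →
      Tendsto (fun m => ∫ x in unitCube n ∩ E, UU p (φ m) N x) atTop
        (nhds (-f ^ p / (p - 1) * (volume (unitCube n ∩ E)).toReal)) := by
    intro N E hE
    have k1 := step_tendsto (g := fun m x => E.indicator (fun _ => (1:ℝ)) x * UU p (φ m) N x)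
      (g₀ := fun x => E.indicator (fun _ => (1:ℝ)) x * (-f ^ p / (p - 1)))
      (fun m => Step.mul hE (step_UU p (φ m) N)) (Step.mul hE (fun _ _ _ => rfl))
      (fun x hx => by
        refine Tendsto.const_mul _ ?_
        unfold UU
        have a1 := hmx N x hx
        have a2 := hav N x hx
        have := (a1.rpow_const (p := p) (Or.inr hp0.le)).sub
          (((a1.rpow_const (p := p - 1) (Or.inr hp1.le)).mul a2).const_mul (p / (p - 1)))
        convert this using 2
        rw [pm hp hf0]
        field_simp
        ring)
    simp_rw [set_eq hE] at k1
    rw [setIntegral_const, smul_eq_mul, mul_comm] at k1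
    exact k1
  intro I hID
  obtain ⟨N, x₀, hx₀, rfl⟩ := (dyadic_iff I).1 hID
  have hsub := cube_sub_Q N hx₀
  have hS : SS N (cube N x₀) := by
    intro x y h
    have : x ∈ cube N x₀ ↔ y ∈ cube N x₀ := by
      show idx N x = idx N x₀ ↔ idx N y = idx N x₀
      rw [h]
    by_cases hx : x ∈ cube N x₀
    · simp [hx, this.1 hx]
    · have hy : y ∉ cube N x₀ := fun hy => hx (this.2 hy)
      simp [hx, hy]
  have hS' : SS N (cube N x₀)ᶜ := by
    intro x y h
    have := hS x y h
    simp only [indicator_compl, Pi.sub_apply]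
    rw [this]
  have hMn : ∀ m, ∀ x ∈ unitCube n, 0 ≤ dyadicMax n (φ m) x := fun m x hx => by
    rw [max_eq _ hx]; exact Real.iSup_nonneg fun k => av_nonneg (hφ0 m) k x
  have hcm := cube_meas N x₀
  have hfinal := numbers (a := fun m => ∫ x in unitCube n ∩ cube N x₀, dyadicMax n (φ m) x ^ p)
    (a' := fun m => ∫ x in unitCube n ∩ (cube N x₀)ᶜ, dyadicMax n (φ m) x ^ p)
    (b := fun m => ∫ x in unitCube n ∩ cube N x₀, φ m x ^ p)
    (b' := fun m => ∫ x in unitCube n ∩ (cube N x₀)ᶜ, φ m x ^ p)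
    hp hf hF hz1 hzeq
    (fun m => setIntegral_nonneg ((Q_meas n).inter hcm)
      fun x hx => Real.rpow_nonneg (hMn m x hx.1) _)
    (fun m => setIntegral_nonneg ((Q_meas n).inter hcm.compl)
      fun x hx => Real.rpow_nonneg (hMn m x hx.1) _)
    (fun m => integral_nonneg fun x => Real.rpow_nonneg (hφ0 m x) _)
    (fun m => integral_nonneg fun x => Real.rpow_nonneg (hφ0 m x) _)
    (h3.congr fun m => by
      have := integral_inter_add_sdiff hcm (lim_facts hp (hφ0 m) (hφm m) (hI m) (hIp m)).2
      rw [sdiff_eq] at this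
      exact this.symm)
    (fun m => by
      have := integral_inter_add_sdiff hcm (hIp m)
      rw [sdiff_eq, h2 m] at this
      exact this)
    (hUU N _ hS) (hUU N _ hS')
    (by
      rw [← sdiff_eq]
      have := measureReal_inter_add_sdiff (μ := volume) (s := unitCube n) hcm (vol_Q_ne_top n)
      simp only [Measure.real] at this
      rw [this, vol_Q])
    (fun m => main_lim hp (hφ0 m) (hφm m) (hI m) (hIp m) hS)
    (fun m => main_lim hp (hφ0 m) (hφm m) (hI m) (hIp m) hS')
  rw [inter_eq_self_of_subset_right hsub] at hfinal
  have hv := (vol_pos N x₀).ne'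
  have := hfinal.const_mul (1 / (volume (cube N x₀)).toReal)
  convert this using 2
  field_simp
end
end

section
/- Let n ≥ 1, let Q = [0,1)^n with Lebesgue measure, let p > 1, let f, F be reals with 0 < f^p ≤ F, and let z ∈ [1, p/(p-1)] satisfy -(p-1)z^p + p z^{p-1} = f^p/F. Let (φ_m)_{m∈ℕ} be a sequence of nonnegative measurable functions on Q with ∫_Q φ_m = f and ∫_Q φ_m^p = F for every m, and with lim_{m→∞} ∫_Q (Mφ_m)^p = F·z^p. Then for every dyadic subcube I of Q, lim_{m→∞} (1/|I|) ∫_I (Mφ_m)^p = F·z^p. -/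
open MeasureTheory Set Filter

noncomputable section

/-! ### Dyadic cubes -/

/-- The dyadic cube of generation `k` around `x`. -/
def cub {n : ℕ} (k : ℕ) (x : Fin n → ℝ) : Set (Fin n → ℝ) :=
  {y | ∀ i, ⌊(2:ℝ) ^ k * y i⌋ = ⌊(2:ℝ) ^ k * x i⌋}

lemma cub_eq_pi {n : ℕ} (k : ℕ) (x : Fin n → ℝ) :
    cub k x = Set.univ.pi fun i =>
      Set.Ico ((⌊(2:ℝ) ^ k * x i⌋ : ℝ) / 2 ^ k) (((⌊(2:ℝ) ^ k * x i⌋ : ℝ) + 1) / 2 ^ k) := by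
  ext y
  simp only [cub, mem_ofPred_eq, mem_univ_pi, mem_Ico]
  refine forall_congr' fun i => ?_
  rw [Int.floor_eq_iff, div_le_iff₀ (by positivity), lt_div_iff₀ (by positivity), mul_comm (y i)]

lemma cub_meas {n : ℕ} (k : ℕ) (x : Fin n → ℝ) : MeasurableSet (cub k x) := by
  rw [cub_eq_pi]
  exact MeasurableSet.univ_pi fun i => measurableSet_Ico

lemma cub_vol' {n : ℕ} (k : ℕ) (x : Fin n → ℝ) :
    volume (cub k x) = ENNReal.ofReal (((2:ℝ) ^ k)⁻¹ ^ n) := by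
  rw [cub_eq_pi, volume_pi_pi]
  have : ∀ i, volume (Set.Ico ((⌊(2:ℝ) ^ k * x i⌋ : ℝ) / 2 ^ k)
      (((⌊(2:ℝ) ^ k * x i⌋ : ℝ) + 1) / 2 ^ k)) = ENNReal.ofReal (((2:ℝ) ^ k)⁻¹) := by
    intro i
    rw [Real.volume_Ico]
    congr 1
    field_simp
    ring
  simp only [this, Finset.prod_const, Finset.card_univ, Fintype.card_fin]
  rw [ENNReal.ofReal_pow (by positivity)]

/-- volume of a cube of generation k -/
def vk (n k : ℕ) : ℝ := ((2:ℝ) ^ k)⁻¹ ^ n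

lemma vk_pos (n k : ℕ) : 0 < vk n k := by unfold vk; positivity

lemma cub_vol {n : ℕ} (k : ℕ) (x : Fin n → ℝ) : (volume (cub k x)).toReal = vk n k := by
  rw [cub_vol', ENNReal.toReal_ofReal (by positivity)]; rfl

lemma cub_vol_ne_top {n : ℕ} (k : ℕ) (x : Fin n → ℝ) : volume (cub k x) ≠ ⊤ := by
  rw [cub_vol']; exact ENNReal.ofReal_ne_top

lemma mem_cub_self {n : ℕ} (k : ℕ) (x : Fin n → ℝ) : x ∈ cub k x := fun _ => rfl

lemma cub_eq_of_mem {n : ℕ} {k : ℕ} {x y : Fin n → ℝ} (h : y ∈ cub k x) : cub k y = cub k x := by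
  ext w
  simp only [cub, mem_ofPred_eq] at *
  simp only [h]

lemma mem_cub_of_succ {n : ℕ} {k : ℕ} {x y : Fin n → ℝ} (h : y ∈ cub (k + 1) x) :
    y ∈ cub k x := by
  intro i
  have key : ∀ t : ℝ, ⌊(2:ℝ) ^ k * t⌋ = ⌊(2:ℝ) ^ (k + 1) * t⌋ / 2 := by
    intro t
    have := Int.floor_div_natCast ((2:ℝ) ^ (k + 1) * t) 2
    rw [show (2:ℝ) ^ (k + 1) * t / ((2:ℕ) : ℝ) = (2:ℝ) ^ k * t by rw [pow_succ]; push_cast; ring]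
      at this
    simpa using this
  rw [key, key, h i]

lemma mem_cub_of_le {n : ℕ} {j k : ℕ} (hjk : j ≤ k) {x y : Fin n → ℝ} (h : y ∈ cub k x) :
    y ∈ cub j x := by
  induction k, hjk using Nat.le_induction with
  | base => exact h
  | succ k hk ih => exact ih (mem_cub_of_succ h)

lemma cub_zero {n : ℕ} {x : Fin n → ℝ} (hx : x ∈ unitCube n) : cub 0 x = unitCube n := by
  rw [cub_eq_pi]
  unfold unitCube at *
  have : ∀ i, ⌊(2:ℝ) ^ 0 * x i⌋ = 0 := by
    intro i
    have := hx i (mem_univ i)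
    rw [Int.floor_eq_iff]
    simpa using this
  simp only [this]
  simp

lemma cub_subset {n : ℕ} (k : ℕ) {x : Fin n → ℝ} (hx : x ∈ unitCube n) :
    cub k x ⊆ unitCube n := by
  intro y hy
  rw [← cub_zero hx]
  exact mem_cub_of_le (Nat.zero_le k) hy

/-- corner points -/
def pt {n : ℕ} (k : ℕ) (κ : Fin n → Fin (2 ^ k)) : Fin n → ℝ := fun i => ((κ i : ℕ) : ℝ) / 2 ^ k

lemma floor_pt {n : ℕ} (k : ℕ) (κ : Fin n → Fin (2 ^ k)) (i : Fin n) :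
    ⌊(2:ℝ) ^ k * pt k κ i⌋ = ((κ i : ℕ) : ℤ) := by
  unfold pt
  rw [mul_div_cancel₀ _ (by positivity)]
  simp

lemma pt_mem {n : ℕ} (k : ℕ) (κ : Fin n → Fin (2 ^ k)) : pt k κ ∈ unitCube n := by
  intro i _
  refine ⟨by unfold pt; positivity, ?_⟩
  unfold pt
  rw [div_lt_one (by positivity)]
  exact_mod_cast (κ i).2

lemma unitCube_eq (n k : ℕ) : unitCube n = ⋃ κ : Fin n → Fin (2 ^ k), cub k (pt k κ) := by
  apply Subset.antisymm
  · intro x hx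
    rw [mem_iUnion]
    have h0 : ∀ i, 0 ≤ ⌊(2:ℝ) ^ k * x i⌋ := fun i => by
      have := (hx i (mem_univ i)).1
      positivity
    have h1 : ∀ i, ⌊(2:ℝ) ^ k * x i⌋ < 2 ^ k := fun i => by
      have := (hx i (mem_univ i)).2
      rw [Int.floor_lt]
      push_cast
      have h2 : (0:ℝ) < 2 ^ k := by positivity
      nlinarith
    refine ⟨fun i => ⟨(⌊(2:ℝ) ^ k * x i⌋).toNat, ?_⟩, fun i => ?_⟩
    · have := h1 i
      have := h0 i
      zify
      rw [Int.toNat_of_nonneg (h0 i)]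
      exact h1 i
    · rw [floor_pt]
      simp only
      rw [Int.toNat_of_nonneg (h0 i)]
  · exact iUnion_subset fun κ => cub_subset k (pt_mem k κ)

lemma cub_pt_disj (n k : ℕ) :
    Pairwise (Function.onFun Disjoint fun κ : Fin n → Fin (2 ^ k) => cub k (pt k κ)) := by
  intro κ κ' hne
  rw [Function.onFun, Set.disjoint_left]
  intro x hx hx'
  apply hne
  ext i
  have h1 := hx i
  have h2 := hx' i
  rw [floor_pt] at h1 h2
  have := h1.symm.trans h2
  exact_mod_cast this

lemma dyadic_eq_cub {n : ℕ} {R : Set (Fin n → ℝ)} (hR : IsDyadicCube n R) :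
    ∃ N, ∀ x ∈ R, R = cub N x := by
  obtain ⟨N, k, hk, rfl⟩ := hR
  refine ⟨N, fun x hx => ?_⟩
  rw [cub_eq_pi]
  have : ∀ i, ⌊(2:ℝ) ^ N * x i⌋ = k i := by
    intro i
    have := hx i (mem_univ i)
    rw [mem_Ico, div_le_iff₀ (by positivity), lt_div_iff₀ (by positivity)] at this
    rw [Int.floor_eq_iff]
    push_cast
    constructor <;> linarith [this.1, this.2]
  simp only [this, Int.cast_natCast]

lemma dyadic_subset {n : ℕ} {R : Set (Fin n → ℝ)} (hR : IsDyadicCube n R) :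
    R ⊆ unitCube n := by
  obtain ⟨N, k, hk, rfl⟩ := hR
  intro x hx i _
  have := hx i (mem_univ i)
  refine ⟨le_trans (by positivity) this.1, lt_of_lt_of_le this.2 ?_⟩
  rw [div_le_one (by positivity)]
  exact_mod_cast hk i

lemma dyadic_nonempty {n : ℕ} {R : Set (Fin n → ℝ)} (hR : IsDyadicCube n R) :
    R.Nonempty := by
  obtain ⟨N, k, hk, rfl⟩ := hR
  refine ⟨fun i => (k i : ℝ) / 2 ^ N, fun i _ => ⟨le_rfl, ?_⟩⟩
  simp only
  gcongr
  linarith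

lemma cub_isDyadic {n : ℕ} (k : ℕ) {x : Fin n → ℝ} (hx : x ∈ unitCube n) :
    IsDyadicCube n (cub k x) := by
  have hx' := hx
  rw [unitCube_eq n k, mem_iUnion] at hx'
  obtain ⟨κ, hκ⟩ := hx'
  rw [cub_eq_of_mem hκ, cub_eq_pi]
  refine ⟨k, fun i => κ i, fun i => (κ i).2, ?_⟩
  simp only [floor_pt, Int.cast_natCast]

/-! ### Averages and truncated maximal functions -/

def avg {n : ℕ} (φ : (Fin n → ℝ) → ℝ) (k : ℕ) (x : Fin n → ℝ) : ℝ :=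
  (vk n k)⁻¹ * ∫ y in cub k x, φ y

def mx {n : ℕ} (φ : (Fin n → ℝ) → ℝ) : ℕ → (Fin n → ℝ) → ℝ
  | 0, x => avg φ 0 x
  | (k + 1), x => max (mx φ k x) (avg φ (k + 1) x)

lemma dyadicMax_eq {n : ℕ} (φ : (Fin n → ℝ) → ℝ) {x : Fin n → ℝ} (hx : x ∈ unitCube n) :
    dyadicMax n φ x = ⨆ k, avg φ k x := by
  unfold dyadicMax iSup
  congr 1
  ext a
  simp only [mem_ofPred_eq, mem_range]
  constructor
  · rintro ⟨R, hR, hxR, rfl⟩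
    obtain ⟨N, hN⟩ := dyadic_eq_cub hR
    refine ⟨N, ?_⟩
    rw [hN x hxR, cub_vol]; rfl
  · rintro ⟨k, rfl⟩
    exact ⟨cub k x, cub_isDyadic k hx, mem_cub_self k x, by rw [cub_vol]; rfl⟩

/-- `u` is constant on the cubes of generation `k` inside the unit cube. -/
def CC {n : ℕ} (k : ℕ) (u : (Fin n → ℝ) → ℝ) : Prop :=
  ∀ x ∈ unitCube n, ∀ y ∈ cub k x, u y = u x

lemma CC.mono {n : ℕ} {j k : ℕ} (hjk : j ≤ k) {u : (Fin n → ℝ) → ℝ} (h : CC j u) : CC k u :=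
  fun x hx y hy => h x hx y (mem_cub_of_le hjk hy)

lemma avg_CC {n : ℕ} (φ : (Fin n → ℝ) → ℝ) (k : ℕ) : CC k (avg φ k) := by
  intro x hx y hy
  unfold avg
  rw [cub_eq_of_mem hy]

lemma mx_CC {n : ℕ} (φ : (Fin n → ℝ) → ℝ) (k : ℕ) : CC k (mx φ k) := by
  induction k with
  | zero => exact avg_CC φ 0
  | succ k ih =>
    intro x hx y hy
    simp only [mx]
    rw [ih x hx y (mem_cub_of_succ hy), avg_CC φ (k + 1) x hx y hy]

lemma integrableOn_of_cubes {n : ℕ} (k : ℕ) {u : (Fin n → ℝ) → ℝ}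
    (h : ∀ x ∈ unitCube n, IntegrableOn u (cub k x)) : IntegrableOn u (unitCube n) := by
  rw [unitCube_eq n k, integrableOn_finite_iUnion]
  exact fun κ => h _ (pt_mem k κ)

lemma integral_cubes {n : ℕ} (k : ℕ) {u : (Fin n → ℝ) → ℝ} (h : IntegrableOn u (unitCube n)) :
    ∫ x in unitCube n, u x = ∑ κ : Fin n → Fin (2 ^ k), ∫ x in cub k (pt k κ), u x := by
  conv_lhs => rw [unitCube_eq n k]
  exact integral_iUnion_fintype (fun κ => cub_meas k _) (cub_pt_disj n k)
    fun κ => h.mono_set (cub_subset k (pt_mem k κ))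

lemma CC.mul_integrable {n : ℕ} {k : ℕ} {w φ : (Fin n → ℝ) → ℝ} (hw : CC k w)
    (hφ : IntegrableOn φ (unitCube n)) : IntegrableOn (fun x => w x * φ x) (unitCube n) := by
  apply integrableOn_of_cubes k
  intro x hx
  have h1 : IntegrableOn (fun y => w x * φ y) (cub k x) :=
    (hφ.mono_set (cub_subset k hx)).const_mul (w x)
  exact h1.congr_fun (fun y hy => by simp only [hw x hx y hy]) (cub_meas k x)

lemma integrableOn_one (n : ℕ) : IntegrableOn (fun _ => (1:ℝ)) (unitCube n) := by
  apply integrableOn_of_cubes 0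
  intro x _
  exact integrableOn_const (cub_vol_ne_top 0 x)

lemma CC.integrable {n : ℕ} {k : ℕ} {w : (Fin n → ℝ) → ℝ} (hw : CC k w) :
    IntegrableOn w (unitCube n) := by
  simpa using hw.mul_integrable (integrableOn_one n)

lemma CC.integral_cub {n : ℕ} {k : ℕ} {w : (Fin n → ℝ) → ℝ} (hw : CC k w)
    {x : Fin n → ℝ} (hx : x ∈ unitCube n) : ∫ y in cub k x, w y = vk n k * w x := by
  rw [setIntegral_congr_fun (g := fun _ => w x) (cub_meas k x) (fun y hy => hw x hx y hy)]
  rw [setIntegral_const, Measure.real, cub_vol, smul_eq_mul]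

lemma CC.integral {n : ℕ} {k : ℕ} {w : (Fin n → ℝ) → ℝ} (hw : CC k w) :
    ∫ y in unitCube n, w y = ∑ κ : Fin n → Fin (2 ^ k), vk n k * w (pt k κ) := by
  rw [integral_cubes k hw.integrable]
  exact Finset.sum_congr rfl fun κ _ => hw.integral_cub (pt_mem k κ)

lemma CC.le_integral {n : ℕ} {k : ℕ} {w : (Fin n → ℝ) → ℝ} (hw : CC k w)
    (h0 : ∀ x ∈ unitCube n, 0 ≤ w x)
    {x : Fin n → ℝ} (hx : x ∈ unitCube n) : vk n k * w x ≤ ∫ y in unitCube n, w y := by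
  rw [← hw.integral_cub hx]
  exact setIntegral_mono_set hw.integrable
    ((ae_restrict_iff' (unitCube_meas n)).2 (ae_of_all _ h0)) (cub_subset k hx).eventuallyLE

lemma integral_cub_avg {n : ℕ} (φ : (Fin n → ℝ) → ℝ) (k : ℕ) (x : Fin n → ℝ) :
    ∫ y in cub k x, φ y = vk n k * avg φ k x := by
  unfold avg
  rw [mul_inv_cancel_left₀ (vk_pos n k).ne']

lemma CC.integral_avg {n : ℕ} {k : ℕ} {w φ : (Fin n → ℝ) → ℝ} (hw : CC k w)
    (hφ : IntegrableOn φ (unitCube n)) :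
    ∫ x in unitCube n, w x * φ x = ∫ x in unitCube n, w x * avg φ k x := by
  rw [integral_cubes k (hw.mul_integrable hφ),
    integral_cubes k (hw.mul_integrable (avg_CC φ k).integrable)]
  refine Finset.sum_congr rfl fun κ _ => ?_
  have hx := pt_mem k κ
  have hw' : ∀ ψ : (Fin n → ℝ) → ℝ, ∫ x in cub k (pt k κ), w x * ψ x
      = w (pt k κ) * ∫ x in cub k (pt k κ), ψ x := by
    intro ψ
    rw [← integral_const_mul]
    exact setIntegral_congr_fun (cub_meas k _) fun y hy => by simp only [hw _ hx y hy]
  rw [hw', hw', (avg_CC φ k).integral_cub hx, integral_cub_avg]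

/-! ### Young inequality and the elementary functional -/

lemma young_strict {p : ℝ} (hp : 1 < p) {x y : ℝ} (hx : 0 ≤ x) (hy : 0 ≤ y) (hxy : x ≠ y) :
    p * x * y ^ (p - 1) < x ^ p + (p - 1) * y ^ p := by
  rcases hy.eq_or_lt with rfl | hy
  · rw [Real.zero_rpow (by linarith), Real.zero_rpow (by linarith)]
    have : 0 < x ^ p := Real.rpow_pos_of_pos (lt_of_le_of_ne hx hxy.symm) _
    simpa using this
  · have h := one_add_mul_self_lt_rpow_one_add (s := x / y - 1)
      (by have : 0 ≤ x / y := by positivity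
          linarith) (by rw [sub_ne_zero, Ne, div_eq_one_iff_eq hy.ne']; exact hxy) hp
    rw [add_sub_cancel, Real.div_rpow hx hy.le, lt_div_iff₀ (by positivity)] at h
    have e : y ^ p = y ^ (p - 1) * y := by
      rw [← Real.rpow_add_one hy.ne']; ring_nf
    have e2 : (1 + p * (x / y - 1)) * y ^ p = p * x * y ^ (p - 1) - (p - 1) * y ^ p := by
      rw [e]; field_simp; ring
    linarith

lemma rpow_split {p : ℝ} (hp : 1 < p) {x : ℝ} (hx : 0 ≤ x) : x * x ^ (p - 1) = x ^ p := by
  rcases hx.eq_or_lt with rfl | hx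
  · rw [zero_mul, Real.zero_rpow (by linarith)]
  · rw [mul_comm, ← Real.rpow_add_one hx.ne']; ring_nf

lemma young {p : ℝ} (hp : 1 < p) {x y : ℝ} (hx : 0 ≤ x) (hy : 0 ≤ y) :
    p * x * y ^ (p - 1) ≤ x ^ p + (p - 1) * y ^ p := by
  by_cases hxy : x = y
  · subst hxy
    rw [mul_assoc, rpow_split hp hx]
    linarith
  · exact (young_strict hp hx hy hxy).le

def hh (p L a : ℝ) : ℝ := (p - 1) * L ^ p - p * a * L ^ (p - 1)

def dd (p L a : ℝ) : ℝ := hh p L a - hh p (max L a) a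

lemma hh_self {p : ℝ} (hp : 1 < p) {a : ℝ} (ha : 0 ≤ a) : hh p a a = - a ^ p := by
  unfold hh
  rw [mul_assoc, rpow_split hp ha]
  ring

lemma dd_nonneg {p : ℝ} (hp : 1 < p) {L a : ℝ} (hL : 0 ≤ L) (ha : 0 ≤ a) : 0 ≤ dd p L a := by
  unfold dd
  rcases le_total a L with h | h
  · rw [max_eq_left h]; simp
  · rw [max_eq_right h, hh_self hp ha]
    unfold hh
    linarith [young hp ha hL]

lemma dd_pos {p : ℝ} (hp : 1 < p) {L a : ℝ} (hL : 0 ≤ L) (h : L < a) : 0 < dd p L a := by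
  unfold dd
  have ha := hL.trans h.le
  rw [max_eq_right h.le, hh_self hp ha]
  unfold hh
  linarith [young_strict hp ha hL (ne_of_lt h).symm]

/-! ### Analysis of one function -/

section single

variable {n : ℕ} {φ : (Fin n → ℝ) → ℝ}

lemma avg_nonneg (h0 : ∀ x, 0 ≤ φ x) (k : ℕ) (x : Fin n → ℝ) : 0 ≤ avg φ k x :=
  mul_nonneg (inv_nonneg.2 (vk_pos n k).le) (integral_nonneg h0)

lemma avg_le_mx (k : ℕ) (x : Fin n → ℝ) : avg φ k x ≤ mx φ k x := by
  cases k with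
  | zero => exact le_rfl
  | succ k => exact le_max_right _ _

lemma mx_nonneg (h0 : ∀ x, 0 ≤ φ x) (k : ℕ) (x : Fin n → ℝ) : 0 ≤ mx φ k x :=
  (avg_nonneg h0 k x).trans (avg_le_mx k x)

lemma mx_mono (x : Fin n → ℝ) : Monotone fun k => mx φ k x :=
  monotone_nat_of_le_succ fun _ => le_max_left _ _

lemma mx_le {x : Fin n → ℝ} (hb : BddAbove (range fun k => avg φ k x)) (k : ℕ) :
    mx φ k x ≤ ⨆ k, avg φ k x := by
  induction k with
  | zero => exact le_ciSup hb 0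
  | succ k ih => exact max_le ih (le_ciSup hb (k + 1))

lemma mx_tendsto {x : Fin n → ℝ} (hb : BddAbove (range fun k => avg φ k x)) :
    Tendsto (fun k => mx φ k x) atTop (nhds (⨆ k, avg φ k x)) := by
  have hb' : BddAbove (range fun k => mx φ k x) :=
    ⟨_, by rintro _ ⟨k, rfl⟩; exact mx_le hb k⟩
  have := tendsto_atTop_ciSup (mx_mono (φ := φ) x) hb'
  convert this using 2
  exact le_antisymm (ciSup_mono hb' fun k => avg_le_mx k x) (ciSup_le fun k => mx_le hb k)

lemma avg_zero {x : Fin n → ℝ} (hx : x ∈ unitCube n) :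
    avg φ 0 x = ∫ y in unitCube n, φ y := by
  unfold avg
  rw [cub_zero hx]
  simp [vk]

def TT (p : ℝ) (w φ g : (Fin n → ℝ) → ℝ) : ℝ :=
  ∫ x in unitCube n, w x * ((p - 1) * g x ^ p - p * φ x * g x ^ (p - 1))

lemma CC.rpow {k : ℕ} {g : (Fin n → ℝ) → ℝ} (hg : CC k g) (s : ℝ) : CC k fun x => g x ^ s :=
  fun x hx y hy => by simp only [hg x hx y hy]

lemma CC.mul {k : ℕ} {g w : (Fin n → ℝ) → ℝ} (hg : CC k g) (hw : CC k w) :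
    CC k fun x => g x * w x :=
  fun x hx y hy => by simp only [hg x hx y hy, hw x hx y hy]

lemma CC.cmul {k : ℕ} {g : (Fin n → ℝ) → ℝ} (hg : CC k g) (c : ℝ) :
    CC k fun x => c * g x :=
  fun x hx y hy => by simp only [hg x hx y hy]

lemma TT_integrable {p : ℝ} {k : ℕ} {w g : (Fin n → ℝ) → ℝ} (hw : CC k w) (hg : CC k g)
    {ψ : (Fin n → ℝ) → ℝ} (hψ : IntegrableOn ψ (unitCube n)) :
    IntegrableOn (fun x => w x * ((p - 1) * g x ^ p - p * ψ x * g x ^ (p - 1))) (unitCube n) := by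
  have h1 : IntegrableOn (fun x => (p - 1) * (w x * g x ^ p)) (unitCube n) :=
    ((hw.mul (hg.rpow p)).cmul (p - 1)).integrable
  have h2 := ((hw.mul (hg.rpow (p - 1))).cmul p).mul_integrable hψ
  exact (h1.sub h2).congr_fun (fun x _ => by simp only [Pi.sub_apply]; ring) (unitCube_meas n)

lemma TT_eq {p : ℝ} {k : ℕ} {w g : (Fin n → ℝ) → ℝ} (hw : CC k w) (hg : CC k g)
    (hφ : IntegrableOn φ (unitCube n)) :
    TT p w φ g = ∫ x in unitCube n, w x * hh p (g x) (avg φ k x) := by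
  have h1 : IntegrableOn (fun x => (p - 1) * (w x * g x ^ p)) (unitCube n) :=
    ((hw.mul (hg.rpow p)).cmul (p - 1)).integrable
  have hc := (hw.mul (hg.rpow (p - 1))).cmul p
  have h2 := hc.mul_integrable hφ
  have h3 := hc.mul_integrable (avg_CC φ k).integrable
  unfold TT
  calc _ = ∫ x in unitCube n, ((p - 1) * (w x * g x ^ p) - p * (w x * g x ^ (p - 1)) * φ x) := by
        congr 1; ext x; ring
    _ = (∫ x in unitCube n, (p - 1) * (w x * g x ^ p))
        - ∫ x in unitCube n, p * (w x * g x ^ (p - 1)) * φ x := integral_sub h1 h2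
    _ = (∫ x in unitCube n, (p - 1) * (w x * g x ^ p))
        - ∫ x in unitCube n, p * (w x * g x ^ (p - 1)) * avg φ k x := by rw [hc.integral_avg hφ]
    _ = ∫ x in unitCube n,
        ((p - 1) * (w x * g x ^ p) - p * (w x * g x ^ (p - 1)) * avg φ k x) :=
        (integral_sub h1 h3).symm
    _ = _ := by congr 1; ext x; unfold hh; ring

lemma TT_step {p : ℝ} {k : ℕ} {w : (Fin n → ℝ) → ℝ} (hw : CC k w)
    (hφ : IntegrableOn φ (unitCube n)) :
    TT p w φ (mx φ k) - TT p w φ (mx φ (k + 1))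
      = ∫ x in unitCube n, w x * dd p (mx φ k x) (avg φ (k + 1) x) := by
  have hw' := hw.mono (Nat.le_succ k)
  have hm := (mx_CC φ k).mono (Nat.le_succ k)
  have hm' := mx_CC φ (k + 1)
  have ha := avg_CC φ (k + 1)
  rw [TT_eq hw' hm hφ, TT_eq hw' hm' hφ, ← integral_sub]
  · congr 1; ext x; unfold dd; simp only [mx]; ring
  · exact (TT_integrable hw' hm ha.integrable)
  · exact (TT_integrable hw' hm' ha.integrable)

lemma TT_step_nonneg {p : ℝ} (hp : 1 < p) (h0 : ∀ x, 0 ≤ φ x) {k : ℕ} {w : (Fin n → ℝ) → ℝ}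
    (hw : CC k w) (hw0 : ∀ x, 0 ≤ w x) (hφ : IntegrableOn φ (unitCube n)) :
    TT p w φ (mx φ (k + 1)) ≤ TT p w φ (mx φ k) := by
  rw [← sub_nonneg, TT_step hw hφ]
  exact integral_nonneg fun x =>
    mul_nonneg (hw0 x) (dd_nonneg hp (mx_nonneg h0 k x) (avg_nonneg h0 _ x))

lemma TT_anti {p : ℝ} (hp : 1 < p) (h0 : ∀ x, 0 ≤ φ x) {N k : ℕ} (hNk : N ≤ k)
    {w : (Fin n → ℝ) → ℝ}
    (hw : CC N w) (hw0 : ∀ x, 0 ≤ w x) (hφ : IntegrableOn φ (unitCube n)) :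
    TT p w φ (mx φ k) ≤ TT p w φ (mx φ N) := by
  induction k, hNk using Nat.le_induction with
  | base => exact le_rfl
  | succ k hk ih => exact (TT_step_nonneg hp h0 (hw.mono hk) hw0 hφ).trans ih

lemma CC_one (k : ℕ) : CC (n := n) k fun _ => (1:ℝ) := fun _ _ _ _ => rfl

lemma vol_unit (n : ℕ) : ∫ _ in unitCube n, (1:ℝ) = 1 := by
  have hx : (pt 0 (fun _ => ⟨0, by norm_num⟩) : Fin n → ℝ) ∈ unitCube n := pt_mem 0 _
  have := (CC_one (n := n) 0).integral_cub hx
  rw [cub_zero hx] at this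
  rw [this]; simp [vk]

lemma TT_zero {p : ℝ} (hp : 1 < p) (h0 : ∀ x, 0 ≤ φ x) (hφ : IntegrableOn φ (unitCube n)) :
    TT p (fun _ => 1) φ (mx φ 0) = - (∫ x in unitCube n, φ x) ^ p := by
  rw [TT_eq (CC_one 0) (mx_CC φ 0) hφ]
  have : ∀ x ∈ unitCube n, (1:ℝ) * hh p (mx φ 0 x) (avg φ 0 x)
      = - (∫ x in unitCube n, φ x) ^ p * 1 := by
    intro x hx
    simp only [mx]
    rw [hh_self hp (avg_nonneg h0 0 x), avg_zero hx]; ring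
  rw [setIntegral_congr_fun (unitCube_meas n) this, integral_const_mul, vol_unit, mul_one]

lemma mx_bound {p : ℝ} (hp : 1 < p) (h0 : ∀ x, 0 ≤ φ x) (hφ : IntegrableOn φ (unitCube n))
    (hφp : IntegrableOn (fun x => φ x ^ p) (unitCube n)) (k : ℕ) :
    ∫ x in unitCube n, mx φ k x ^ p ≤ 2 ^ p * (∫ x in unitCube n, φ x ^ p) / (p - 1) := by
  have h1 := TT_anti hp h0 (Nat.zero_le k) (CC_one 0) (fun _ => zero_le_one) hφ
  rw [TT_zero hp h0 hφ] at h1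
  have hf : 0 ≤ (∫ x in unitCube n, φ x) ^ p := Real.rpow_nonneg (integral_nonneg h0) _
  have hm : IntegrableOn (fun x => mx φ k x ^ p) (unitCube n) := ((mx_CC φ k).rpow p).integrable
  have h2 : (∫ x in unitCube n, ((p - 1) / 2 * mx φ k x ^ p - 2 ^ p / 2 * φ x ^ p))
      ≤ TT p (fun _ => 1) φ (mx φ k) := by
    unfold TT
    apply integral_mono ((hm.const_mul _).sub (hφp.const_mul _))
      (TT_integrable (CC_one k) (mx_CC φ k) hφ)
    intro x
    simp only [Pi.sub_apply]
    have := young hp (mul_nonneg zero_le_two (h0 x)) (mx_nonneg h0 k x)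
    rw [Real.mul_rpow zero_le_two (h0 x)] at this
    linarith
  rw [integral_sub (hm.const_mul _) (hφp.const_mul _), integral_const_mul,
    integral_const_mul] at h2
  rw [le_div_iff₀ (by linarith)]
  nlinarith

/-- a.e. finiteness and integrability of the maximal function -/
lemma max_props {p : ℝ} (hp : 1 < p) (h0 : ∀ x, 0 ≤ φ x) (hφ : IntegrableOn φ (unitCube n))
    (hφp : IntegrableOn (fun x => φ x ^ p) (unitCube n)) :
    (∀ᵐ x ∂(volume.restrict (unitCube n)), (∀ k, mx φ k x ≤ dyadicMax n φ x) ∧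
      Tendsto (fun k => mx φ k x) atTop (nhds (dyadicMax n φ x))) ∧
    IntegrableOn (fun x => dyadicMax n φ x ^ p) (unitCube n) ∧
    IntegrableOn (fun x => φ x * dyadicMax n φ x ^ (p - 1)) (unitCube n) := by
  have hp0 : 0 < p := by linarith
  have hm : ∀ k, IntegrableOn (fun x => mx φ k x ^ p) (unitCube n) :=
    fun k => ((mx_CC φ k).rpow p).integrable
  have hmeas : ∀ k, AEMeasurable (fun x => ENNReal.ofReal (mx φ k x ^ p))
      (volume.restrict (unitCube n)) := fun k => (hm k).aemeasurable.ennreal_ofReal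
  set C := 2 ^ p * (∫ x in unitCube n, φ x ^ p) / (p - 1)
  have hl : ∫⁻ x in unitCube n, ⨆ k, ENNReal.ofReal (mx φ k x ^ p) ≤ ENNReal.ofReal C := by
    rw [lintegral_iSup' hmeas (ae_of_all _ fun x j k hjk => ENNReal.ofReal_le_ofReal
      (Real.rpow_le_rpow (mx_nonneg h0 j x) (mx_mono x hjk) hp0.le))]
    refine iSup_le fun k => ?_
    rw [← ofReal_integral_eq_lintegral_ofReal (hm k)
      (ae_of_all _ fun x => Real.rpow_nonneg (mx_nonneg h0 k x) _)]
    exact ENNReal.ofReal_le_ofReal (mx_bound hp h0 hφ hφp k)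
  have hlt := ae_lt_top' (AEMeasurable.iSup hmeas) (ne_top_of_le_ne_top ENNReal.ofReal_ne_top hl)
  have hA : ∀ᵐ x ∂(volume.restrict (unitCube n)), (∀ k, mx φ k x ≤ dyadicMax n φ x) ∧
      Tendsto (fun k => mx φ k x) atTop (nhds (dyadicMax n φ x)) := by
    filter_upwards [hlt, ae_restrict_mem (unitCube_meas n)] with x hx hxQ
    have hb : BddAbove (range fun k => avg φ k x) := by
      refine ⟨(⨆ k, ENNReal.ofReal (mx φ k x ^ p)).toReal ^ p⁻¹, ?_⟩
      rintro _ ⟨k, rfl⟩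
      simp only
      have h1 : mx φ k x ^ p ≤ (⨆ k, ENNReal.ofReal (mx φ k x ^ p)).toReal := by
        rw [← ENNReal.ofReal_le_iff_le_toReal hx.ne]
        exact le_iSup (fun k => ENNReal.ofReal (mx φ k x ^ p)) k
      refine (avg_le_mx k x).trans ?_
      rw [Real.le_rpow_inv_iff_of_pos (mx_nonneg h0 k x) ENNReal.toReal_nonneg hp0]
      exact h1
    rw [dyadicMax_eq φ hxQ]
    exact ⟨mx_le hb, mx_tendsto hb⟩
  have hGm : AEStronglyMeasurable (dyadicMax n φ) (volume.restrict (unitCube n)) :=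
    aestronglyMeasurable_of_tendsto_ae atTop
      (fun k => (mx_CC φ k).integrable.aestronglyMeasurable) (hA.mono fun x hx => hx.2)
  have hG0 : ∀ᵐ x ∂(volume.restrict (unitCube n)), 0 ≤ dyadicMax n φ x :=
    hA.mono fun x hx => (mx_nonneg h0 0 x).trans (hx.1 0)
  have hGp : ∀ s : ℝ, AEStronglyMeasurable (fun x => dyadicMax n φ x ^ s)
      (volume.restrict (unitCube n)) :=
    fun s => (hGm.aemeasurable.pow_const s).aestronglyMeasurable
  have hGi : IntegrableOn (fun x => dyadicMax n φ x ^ p) (unitCube n) := by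
    refine ⟨hGp p, ?_⟩
    rw [hasFiniteIntegral_iff_ofReal (hG0.mono fun x hx => Real.rpow_nonneg hx _)]
    refine lt_of_le_of_lt (lintegral_mono_ae ?_) (lt_of_le_of_lt hl ENNReal.ofReal_lt_top)
    filter_upwards [hA] with x hx
    have ht : Tendsto (fun k => ENNReal.ofReal (mx φ k x ^ p)) atTop
        (nhds (ENNReal.ofReal (dyadicMax n φ x ^ p))) :=
      ENNReal.tendsto_ofReal (hx.2.rpow_const (Or.inr hp0.le))
    exact le_of_tendsto' ht fun k => le_iSup (fun k => ENNReal.ofReal (mx φ k x ^ p)) k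
  refine ⟨hA, hGi, ?_⟩
  refine Integrable.mono' (hφp.add (hGi.const_mul (p - 1)))
    (hφ.aestronglyMeasurable.mul (hGp (p - 1))) ?_
  filter_upwards [hG0] with x hx
  have h1 : 0 ≤ φ x * dyadicMax n φ x ^ (p - 1) := mul_nonneg (h0 x) (Real.rpow_nonneg hx _)
  rw [Real.norm_of_nonneg h1]
  have := young hp (h0 x) hx
  simp only [Pi.add_apply]
  nlinarith

lemma TT_tendsto {p : ℝ} (hp : 1 < p) (h0 : ∀ x, 0 ≤ φ x) (hφ : IntegrableOn φ (unitCube n))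
    (hφp : IntegrableOn (fun x => φ x ^ p) (unitCube n)) {N : ℕ} {w : (Fin n → ℝ) → ℝ}
    (hw : CC N w) (hw0 : ∀ x, 0 ≤ w x) (hw1 : ∀ x, w x ≤ 1) :
    Tendsto (fun k => TT p w φ (mx φ k)) atTop (nhds (TT p w φ (dyadicMax n φ))) := by
  obtain ⟨hA, hG, hφG⟩ := max_props hp h0 hφ hφp
  unfold TT
  refine tendsto_integral_of_dominated_convergence
    (fun x => (p - 1) * dyadicMax n φ x ^ p + p * (φ x * dyadicMax n φ x ^ (p - 1)))
    ?_ ((hG.const_mul _).add (hφG.const_mul _)) ?_ ?_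
  · intro k
    have hwm := hw.integrable.aestronglyMeasurable
    have h1 := ((mx_CC φ k).rpow p).integrable.aestronglyMeasurable
    have h2 := ((mx_CC φ k).rpow (p - 1)).integrable.aestronglyMeasurable
    exact hwm.mul ((h1.const_mul (p - 1)).sub ((hφ.aestronglyMeasurable.const_mul p).mul h2))
  · intro k
    filter_upwards [hA] with x hx
    have hm := mx_nonneg h0 k x
    have e1 : mx φ k x ^ p ≤ dyadicMax n φ x ^ p :=
      Real.rpow_le_rpow hm (hx.1 k) (by linarith)
    have e2 : mx φ k x ^ (p - 1) ≤ dyadicMax n φ x ^ (p - 1) :=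
      Real.rpow_le_rpow hm (hx.1 k) (by linarith)
    have e3 := Real.rpow_nonneg hm p
    have e4 := Real.rpow_nonneg hm (p - 1)
    have hφx := h0 x
    have hpp : 0 < p - 1 := by linarith
    rw [norm_mul, Real.norm_of_nonneg (hw0 x)]
    refine (mul_le_of_le_one_left (norm_nonneg _) (hw1 x)).trans ?_
    refine (norm_sub_le _ _).trans ?_
    rw [Real.norm_of_nonneg (by positivity), Real.norm_of_nonneg (by positivity), mul_assoc p]
    gcongr
  · filter_upwards [hA] with x hx
    exact (((hx.2.rpow_const (Or.inr (by linarith))).const_mul _).sub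
      ((hx.2.rpow_const (Or.inr (by linarith))).const_mul _)).const_mul _

lemma TT_le {p : ℝ} (hp : 1 < p) (h0 : ∀ x, 0 ≤ φ x) (hφ : IntegrableOn φ (unitCube n))
    (hφp : IntegrableOn (fun x => φ x ^ p) (unitCube n)) {N : ℕ} {w : (Fin n → ℝ) → ℝ}
    (hw : CC N w) (hw0 : ∀ x, 0 ≤ w x) (hw1 : ∀ x, w x ≤ 1) :
    TT p w φ (dyadicMax n φ) ≤ TT p w φ (mx φ N) := by
  refine le_of_tendsto (TT_tendsto hp h0 hφ hφp hw hw0 hw1) ?_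
  filter_upwards [eventually_ge_atTop N] with k hk
  exact TT_anti hp h0 hk hw hw0 hφ

/-- The deficit. -/
def defi (p : ℝ) (φ : (Fin n → ℝ) → ℝ) : ℝ :=
  - (∫ x in unitCube n, φ x) ^ p - TT p (fun _ => 1) φ (dyadicMax n φ)

lemma dd_int_le {p : ℝ} (hp : 1 < p) (h0 : ∀ x, 0 ≤ φ x) (hφ : IntegrableOn φ (unitCube n))
    (hφp : IntegrableOn (fun x => φ x ^ p) (unitCube n)) (k : ℕ) :
    ∫ x in unitCube n, dd p (mx φ k x) (avg φ (k + 1) x) ≤ defi p φ := by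
  have h := TT_step (p := p) (CC_one k) hφ
  simp only [one_mul] at h
  rw [← h]
  have h1 := TT_anti hp h0 (Nat.zero_le k) (CC_one 0) (fun _ => zero_le_one) hφ
  rw [TT_zero hp h0 hφ] at h1
  have h2 := TT_le hp h0 hφ hφp (CC_one (k + 1)) (fun _ => zero_le_one) (fun _ => le_rfl)
  unfold defi
  linarith

lemma TT_gap {p : ℝ} (hp : 1 < p) (h0 : ∀ x, 0 ≤ φ x) (hφ : IntegrableOn φ (unitCube n))
    (hφp : IntegrableOn (fun x => φ x ^ p) (unitCube n)) {N : ℕ} {w : (Fin n → ℝ) → ℝ}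
    (hw : CC N w) (hw0 : ∀ x, 0 ≤ w x) (hw1 : ∀ x, w x ≤ 1) :
    TT p w φ (mx φ N) - TT p w φ (dyadicMax n φ) ≤ defi p φ := by
  have hw' : CC N fun x => 1 - w x := fun x hx y hy => by simp only [hw x hx y hy]
  have hlim := (TT_tendsto hp h0 hφ hφp (CC_one N) (fun _ => zero_le_one) (fun _ => le_rfl)).sub
    (TT_tendsto hp h0 hφ hφp hw hw0 hw1)
  have hs : ∀ k, N ≤ k → TT p (fun x => 1 - w x) φ (mx φ k)
      = TT p (fun _ => 1) φ (mx φ k) - TT p w φ (mx φ k) := by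
    intro k hk
    unfold TT
    rw [← integral_sub (TT_integrable (CC_one k) (mx_CC φ k) hφ)
      (TT_integrable (hw.mono hk) (mx_CC φ k) hφ)]
    congr 1; ext x; ring
  have h3 : TT p (fun _ => 1) φ (dyadicMax n φ) - TT p w φ (dyadicMax n φ)
      ≤ TT p (fun _ => 1) φ (mx φ N) - TT p w φ (mx φ N) := by
    refine le_of_tendsto hlim ?_
    filter_upwards [eventually_ge_atTop N] with k hk
    rw [← hs k hk, ← hs N le_rfl]
    exact TT_anti hp h0 hk hw' (fun x => sub_nonneg.2 (hw1 x)) hφ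
  have h1 := TT_anti hp h0 (Nat.zero_le N) (CC_one 0) (fun _ => zero_le_one) hφ
  rw [TT_zero hp h0 hφ] at h1
  unfold defi
  linarith

end single

/-! ### Scalar limit lemmas -/

lemma max_lim {p f C : ℝ} (hp : 1 < p) (hf : 0 ≤ f) {L a : ℕ → ℝ}
    (hL : Tendsto L atTop (nhds f)) (ha0 : ∀ m, 0 ≤ a m) (haC : ∀ m, a m ≤ C)
    (hd : Tendsto (fun m => dd p (L m) (a m)) atTop (nhds 0)) :
    Tendsto (fun m => max (L m) (a m)) atTop (nhds f) := by
  apply tendsto_of_subseq_tendsto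
  intro ns hns
  obtain ⟨b, -, ms, hms, hb⟩ := tendsto_subseq_of_bounded (Metric.isBounded_Icc 0 C)
    (x := fun j => a (ns j)) (fun j => ⟨ha0 _, haC _⟩)
  refine ⟨ms, ?_⟩
  have hsub := hns.comp hms.tendsto_atTop
  have hL' : Tendsto (fun j => L (ns (ms j))) atTop (nhds f) := hL.comp hsub
  have hd' : Tendsto (fun j => dd p (L (ns (ms j))) (a (ns (ms j)))) atTop (nhds 0) :=
    hd.comp hsub
  have hb' : Tendsto (fun j => a (ns (ms j))) atTop (nhds b) := hb
  have hmax := hL'.max hb'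
  have hhc : ∀ {u v : ℕ → ℝ} {x y : ℝ}, Tendsto u atTop (nhds x) → Tendsto v atTop (nhds y) →
      Tendsto (fun j => hh p (u j) (v j)) atTop (nhds (hh p x y)) := by
    intro u v x y hu hv
    unfold hh
    exact ((hu.rpow_const (Or.inr (by linarith))).const_mul _).sub
      ((hv.const_mul _).mul (hu.rpow_const (Or.inr (by linarith))))
  have h0 : dd p f b = 0 :=
    tendsto_nhds_unique ((hhc hL' hb').sub (hhc hmax hb')) hd'
  have hbf : b ≤ f := by
    by_contra hlt
    exact (dd_pos hp hf (not_le.1 hlt)).ne' h0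
  rwa [max_eq_left hbf] at hmax

lemma final_lim {p f F z v K : ℝ} (hp : 1 < p) (hf : 0 < f ^ p) (hF : 0 < F)
    (hz : 1 ≤ z)
    (hzeq : -(p - 1) * z ^ p + p * z ^ (p - 1) = f ^ p / F)
    {A B C : ℕ → ℝ} (hB0 : ∀ m, 0 ≤ B m) (hBK : ∀ m, B m ≤ K)
    (hY : ∀ m, ∀ s : ℝ, 0 ≤ s → 0 ≤ s ^ p * A m + (p - 1) * B m - p * s * C m)
    (hYz : Tendsto (fun m => z ^ p * A m + (p - 1) * B m - p * z * C m) atTop (nhds 0))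
    (hT : Tendsto (fun m => (p - 1) * B m - p * C m) atTop (nhds (- (v * f ^ p)))) :
    Tendsto B atTop (nhds (v * (F * z ^ p))) := by
  have hz0 : 0 < z := by linarith
  have hp0 : 0 < p := by linarith
  have hzp : 0 < z ^ p := by positivity
  apply tendsto_of_subseq_tendsto
  intro ns hns
  obtain ⟨b, -, ms, hms, hb⟩ := tendsto_subseq_of_bounded (Metric.isBounded_Icc 0 K)
    (x := fun j => B (ns j)) (fun j => ⟨hB0 _, hBK _⟩)
  refine ⟨ms, ?_⟩
  have hsub := hns.comp hms.tendsto_atTop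
  have hb' : Tendsto (fun j => B (ns (ms j))) atTop (nhds b) := hb
  have hT' : Tendsto (fun j => (p - 1) * B (ns (ms j)) - p * C (ns (ms j))) atTop
      (nhds (- (v * f ^ p))) := hT.comp hsub
  have hYz' : Tendsto (fun j => z ^ p * A (ns (ms j)) + (p - 1) * B (ns (ms j))
      - p * z * C (ns (ms j))) atTop (nhds 0) := hYz.comp hsub
  obtain ⟨c, hc⟩ : ∃ c, Tendsto (fun j => C (ns (ms j))) atTop (nhds c) := by
    refine ⟨_, (((hb'.const_mul (p - 1)).sub hT').div_const p).congr fun j => ?_⟩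
    field_simp
    ring
  obtain ⟨a, ha⟩ : ∃ a, Tendsto (fun j => A (ns (ms j))) atTop (nhds a) := by
    refine ⟨_, (((hYz'.sub (hb'.const_mul (p - 1))).add (hc.const_mul (p * z))).div_const
      (z ^ p)).congr fun j => ?_⟩
    field_simp
    ring
  have eT : (p - 1) * b - p * c = - (v * f ^ p) :=
    tendsto_nhds_unique ((hb'.const_mul _).sub (hc.const_mul _)) hT'
  have eYs : ∀ s : ℝ, Tendsto (fun j => s ^ p * A (ns (ms j)) + (p - 1) * B (ns (ms j))
      - p * s * C (ns (ms j))) atTop (nhds (s ^ p * a + (p - 1) * b - p * s * c)) := fun s =>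
    ((ha.const_mul _).add (hb'.const_mul _)).sub (hc.const_mul _)
  have eY : z ^ p * a + (p - 1) * b - p * z * c = 0 := tendsto_nhds_unique (eYs z) hYz'
  have hYs : ∀ s : ℝ, 0 ≤ s → 0 ≤ s ^ p * a + (p - 1) * b - p * s * c := fun s hs =>
    ge_of_tendsto' (eYs s) fun j => hY _ s hs
  have hder : HasDerivAt (fun s : ℝ => s ^ p * a + (p - 1) * b - p * s * c)
      (p * z ^ (p - 1) * a - p * c) z := by
    have h1 := (Real.hasDerivAt_rpow_const (x := z) (p := p) (Or.inl hz0.ne')).mul_const a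
    have h2 := ((hasDerivAt_id z).const_mul p).mul_const c
    have h3 := (h1.add_const ((p - 1) * b)).sub h2
    simp only [mul_one] at h3
    exact h3
  have hmin : IsLocalMin (fun s : ℝ => s ^ p * a + (p - 1) * b - p * s * c) z := by
    filter_upwards [lt_mem_nhds hz0] with s hs
    rw [eY]
    exact hYs s hs.le
  have e0 := hmin.hasDerivAt_eq_zero hder
  have ec : c = z ^ (p - 1) * a := by
    have : p * (z ^ (p - 1) * a - c) = 0 := by linarith
    have := (mul_eq_zero.1 this).resolve_left hp0.ne'
    linarith
  have hsp := rpow_split hp hz0.le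
  have eb : b = z ^ p * a := by
    have : (p - 1) * (b - z ^ p * a) = 0 := by
      rw [ec] at eY
      have : p * z * (z ^ (p - 1) * a) = p * z ^ p * a := by rw [← hsp]; ring
      linarith
    have := (mul_eq_zero.1 this).resolve_left (by linarith)
    linarith
  have ea : a = v * F := by
    rw [eb, ec] at eT
    have h1 : a * (-(p - 1) * z ^ p + p * z ^ (p - 1)) = v * f ^ p := by linarith
    rw [hzeq] at h1
    have h2 : f ^ p * (a - v * F) = 0 := by
      field_simp at h1
      rw [h1]; ring
    have := (mul_eq_zero.1 h2).resolve_left hf.ne'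
    linarith
  have : b = v * (F * z ^ p) := by rw [eb, ea]; ring
  rw [← this]
  exact hb'

lemma dyadicMax_nonneg {n : ℕ} {φ : (Fin n → ℝ) → ℝ} (h0 : ∀ x, 0 ≤ φ x) (x : Fin n → ℝ) :
    0 ≤ dyadicMax n φ x := by
  apply Real.sSup_nonneg
  rintro a ⟨R, -, -, rfl⟩
  exact mul_nonneg (inv_nonneg.2 ENNReal.toReal_nonneg) (integral_nonneg h0)

lemma young_pt {n : ℕ} {φ : (Fin n → ℝ) → ℝ} {p : ℝ} (hp : 1 < p) (h0 : ∀ x, 0 ≤ φ x)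
    {s : ℝ} (hs : 0 ≤ s) (x : Fin n → ℝ) :
    0 ≤ s ^ p * φ x ^ p + (p - 1) * dyadicMax n φ x ^ p
      - p * s * (φ x * dyadicMax n φ x ^ (p - 1)) := by
  have := young hp (mul_nonneg hs (h0 x)) (dyadicMax_nonneg h0 x)
  rw [Real.mul_rpow hs (h0 x)] at this
  linarith

/-- Along any extremal sequence, the averages of `(Mφ_m)^p` over every dyadic subcube
tend to `F z^p`. -/
theorem extremal_maxavg_tendsto (n : ℕ) (hn : 1 ≤ n) (p f F z : ℝ) (hp : 1 < p)
    (hf : 0 < f ^ p) (hfF : f ^ p ≤ F)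
    (hz : z ∈ Set.Icc 1 (p / (p - 1)))
    (hzeq : -(p - 1) * z ^ p + p * z ^ (p - 1) = f ^ p / F)
    (φ : ℕ → (Fin n → ℝ) → ℝ)
    (hφ0 : ∀ m x, 0 ≤ φ m x) (hφm : ∀ m, Measurable (φ m))
    (h1 : ∀ m, ∫ x in unitCube n, φ m x = f)
    (h2 : ∀ m, ∫ x in unitCube n, φ m x ^ p = F)
    (h3 : Tendsto (fun m => ∫ x in unitCube n, (dyadicMax n (φ m) x) ^ p)
      atTop (nhds (F * z ^ p))) :
    ∀ I : Set (Fin n → ℝ), IsDyadicCube n I →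
      Tendsto (fun m => (1 / (volume I).toReal) * ∫ x in I, (dyadicMax n (φ m) x) ^ p)
        atTop (nhds (F * z ^ p)) := by
  intro I hI
  have hp0 : 0 < p := by linarith
  have hF : 0 < F := hf.trans_le hfF
  have hz1 : 1 ≤ z := hz.1
  have hz0 : 0 < z := by linarith
  have hf0 : 0 ≤ f := by rw [← h1 0]; exact integral_nonneg (hφ0 0)
  have hfne : f ≠ 0 := by
    rintro rfl
    rw [Real.zero_rpow hp0.ne'] at hf
    exact lt_irrefl _ hf
  have hφi : ∀ m, IntegrableOn (φ m) (unitCube n) := fun m => by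
    by_contra h
    exact hfne ((h1 m).symm.trans (integral_undef h))
  have hφp : ∀ m, IntegrableOn (fun x => φ m x ^ p) (unitCube n) := fun m => by
    by_contra h
    exact hF.ne' ((h2 m).symm.trans (integral_undef h))
  have hGp : ∀ m, IntegrableOn (fun x => dyadicMax n (φ m) x ^ p) (unitCube n) := fun m =>
    (max_props hp (hφ0 m) (hφi m) (hφp m)).2.1
  have hφG : ∀ m, IntegrableOn (fun x => φ m x * dyadicMax n (φ m) x ^ (p - 1)) (unitCube n) :=
    fun m => (max_props hp (hφ0 m) (hφi m) (hφp m)).2.2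
  -- integrated Young expression
  have hYint : ∀ m (s : ℝ), IntegrableOn (fun x => s ^ p * φ m x ^ p
      + (p - 1) * dyadicMax n (φ m) x ^ p
      - p * s * (φ m x * dyadicMax n (φ m) x ^ (p - 1))) (unitCube n) := fun m s =>
    (((hφp m).const_mul _).add ((hGp m).const_mul _)).sub ((hφG m).const_mul _)
  have hYeq : ∀ m (s : ℝ), ∀ S ⊆ unitCube n, ∫ x in S, (s ^ p * φ m x ^ p
      + (p - 1) * dyadicMax n (φ m) x ^ p
      - p * s * (φ m x * dyadicMax n (φ m) x ^ (p - 1)))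
      = s ^ p * (∫ x in S, φ m x ^ p) + (p - 1) * (∫ x in S, dyadicMax n (φ m) x ^ p)
        - p * s * ∫ x in S, φ m x * dyadicMax n (φ m) x ^ (p - 1) := by
    intro m s S hS
    have i1 := ((hφp m).mono_set hS).const_mul (s ^ p)
    have i2 := ((hGp m).mono_set hS).const_mul (p - 1)
    have i3 := ((hφG m).mono_set hS).const_mul (p * s)
    have e1 := integral_sub (i1.add i2) i3
    have e2 := integral_add i1 i2
    simp only [Pi.add_apply] at e1 e2
    rw [e1, e2, integral_const_mul, integral_const_mul, integral_const_mul]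
  have hTeq : ∀ m, ∀ S ⊆ unitCube n, ∫ x in S, ((p - 1) * dyadicMax n (φ m) x ^ p
      - p * φ m x * dyadicMax n (φ m) x ^ (p - 1))
      = (p - 1) * (∫ x in S, dyadicMax n (φ m) x ^ p)
        - p * ∫ x in S, φ m x * dyadicMax n (φ m) x ^ (p - 1) := by
    intro m S hS
    have i2 := ((hGp m).mono_set hS).const_mul (p - 1)
    have i3 := ((hφG m).mono_set hS).const_mul p
    have e1 := integral_sub i2 i3
    rw [integral_const_mul, integral_const_mul] at e1
    rw [← e1]
    congr 1; ext x; ring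
  have hTT1 : ∀ m, TT p (fun _ => 1) (φ m) (dyadicMax n (φ m))
      = (p - 1) * (∫ x in unitCube n, dyadicMax n (φ m) x ^ p)
        - p * ∫ x in unitCube n, φ m x * dyadicMax n (φ m) x ^ (p - 1) := by
    intro m
    rw [← hTeq m _ Subset.rfl]
    unfold TT
    simp only [one_mul]
  have hsp := rpow_split hp hz0.le
  have hfp : f ^ p = F * (-(p - 1) * z ^ p + p * z ^ (p - 1)) := by
    rw [hzeq]; field_simp
  -- the deficit tends to zero
  have hdefi0 : ∀ m, 0 ≤ defi p (φ m) := by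
    intro m
    have a1 := TT_le hp (hφ0 m) (hφi m) (hφp m) (CC_one 0) (fun _ => zero_le_one)
      (fun _ => le_rfl)
    rw [TT_zero hp (hφ0 m) (hφi m)] at a1
    unfold defi
    linarith
  have hdefi : Tendsto (fun m => defi p (φ m)) atTop (nhds 0) := by
    have hup : Tendsto (fun m => - f ^ p
        - ((p - 1) * (∫ x in unitCube n, dyadicMax n (φ m) x ^ p)
          - (z ^ p * F + (p - 1) * (∫ x in unitCube n, dyadicMax n (φ m) x ^ p)) / z))
        atTop (nhds (- f ^ p
        - ((p - 1) * (F * z ^ p) - (z ^ p * F + (p - 1) * (F * z ^ p)) / z))) :=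
      ((h3.const_mul _).sub (((h3.const_mul _).const_add _).div_const _)).const_sub _
    have e : - f ^ p - ((p - 1) * (F * z ^ p) - (z ^ p * F + (p - 1) * (F * z ^ p)) / z) = 0 := by
      rw [hfp, ← hsp]; field_simp; ring
    rw [e] at hup
    refine squeeze_zero hdefi0 (fun m => ?_) hup
    have hy : 0 ≤ ∫ x in unitCube n, (z ^ p * φ m x ^ p
      + (p - 1) * dyadicMax n (φ m) x ^ p
      - p * z * (φ m x * dyadicMax n (φ m) x ^ (p - 1))) :=
      integral_nonneg (young_pt hp (hφ0 m) hz0.le)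
    rw [hYeq m z _ Subset.rfl, h2] at hy
    unfold defi
    rw [hTT1, h1]
    have : p * (∫ x in unitCube n, φ m x * dyadicMax n (φ m) x ^ (p - 1))
        ≤ (z ^ p * F + (p - 1) * (∫ x in unitCube n, dyadicMax n (φ m) x ^ p)) / z := by
      rw [le_div_iff₀ hz0]
      linarith
    linarith
  -- truncated maximal functions tend to f
  have hK : ∀ k, ∀ x ∈ unitCube n, Tendsto (fun m => mx (φ m) k x) atTop (nhds f) := by
    intro k
    induction k with
    | zero =>
      intro x hx
      simp only [mx, avg_zero hx, h1]
      exact tendsto_const_nhds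
    | succ k ih =>
      intro x hx
      simp only [mx]
      refine max_lim (C := (vk n (k + 1))⁻¹ * f) hp hf0 (ih x hx)
        (fun m => avg_nonneg (hφ0 m) _ x) (fun m => ?_) ?_
      · have a1 := (avg_CC (φ m) (k + 1)).le_integral
          (fun y _ => avg_nonneg (hφ0 m) _ y) hx
        have a2 := (CC_one (n := n) (k + 1)).integral_avg (hφi m)
        simp only [one_mul] at a2
        rw [← a2, h1] at a1
        rw [le_inv_mul_iff₀ (vk_pos n (k + 1))]
        exact a1
      · have hb : Tendsto (fun m => (vk n (k + 1))⁻¹ * defi p (φ m)) atTop (nhds 0) := by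
          simpa using hdefi.const_mul (vk n (k + 1))⁻¹
        refine squeeze_zero (fun m => dd_nonneg hp (mx_nonneg (hφ0 m) k x)
          (avg_nonneg (hφ0 m) _ x)) (fun m => ?_) hb
        have hcc : CC (k + 1) fun y => dd p (mx (φ m) k y) (avg (φ m) (k + 1) y) := by
          intro y hy w hw
          simp only [(mx_CC (φ m) k).mono (Nat.le_succ k) y hy w hw,
            avg_CC (φ m) (k + 1) y hy w hw]
        rw [le_inv_mul_iff₀ (vk_pos n (k + 1))]
        exact (hcc.le_integral (fun y _ => dd_nonneg hp (mx_nonneg (hφ0 m) k y)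
          (avg_nonneg (hφ0 m) _ y)) hx).trans (dd_int_le hp (hφ0 m) (hφi m) (hφp m) k)
  have hA : ∀ k, ∀ x ∈ unitCube n, Tendsto (fun m => avg (φ m) k x) atTop (nhds f) := by
    intro k x hx
    have hmint : Tendsto (fun m => ∫ y in unitCube n, mx (φ m) k y) atTop (nhds f) := by
      have hc : CC (n := n) k fun _ => f := fun _ _ _ _ => rfl
      have e : ∑ κ : Fin n → Fin (2 ^ k), vk n k * f = f := by
        rw [← hc.integral]
        have := integral_const_mul (μ := volume.restrict (unitCube n)) f fun _ => (1:ℝ)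
        rw [vol_unit] at this
        simpa using this
      simp only [fun m => (mx_CC (φ m) k).integral]
      conv => rw [← e]
      exact tendsto_finsetSum _ fun κ _ => (hK k _ (pt_mem k κ)).const_mul _
    have hdiff : Tendsto (fun m => mx (φ m) k x - avg (φ m) k x) atTop (nhds 0) := by
      have hb : Tendsto (fun m => (vk n k)⁻¹ * ((∫ y in unitCube n, mx (φ m) k y) - f)) atTop
          (nhds 0) := by
        simpa using (hmint.sub_const f).const_mul (vk n k)⁻¹
      refine squeeze_zero (fun m => sub_nonneg.2 (avg_le_mx k x)) (fun m => ?_) hb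
      rw [le_inv_mul_iff₀ (vk_pos n k)]
      have hcc : CC k fun y => mx (φ m) k y - avg (φ m) k y := by
        intro y hy w hw
        simp only [mx_CC (φ m) k y hy w hw, avg_CC (φ m) k y hy w hw]
      have a1 := hcc.le_integral (fun y _ => sub_nonneg.2 (avg_le_mx k y)) hx
      rw [integral_sub (mx_CC (φ m) k).integrable (avg_CC (φ m) k).integrable] at a1
      have a2 := (CC_one (n := n) k).integral_avg (hφi m)
      simp only [one_mul] at a2
      rwa [← a2, h1] at a1
    simpa using (hK k x hx).sub hdiff
  -- the cube
  obtain ⟨N, hN⟩ := dyadic_eq_cub hI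
  obtain ⟨x0, hx0⟩ := dyadic_nonempty hI
  have hIQ := dyadic_subset hI
  have hxQ := hIQ hx0
  have hIc := hN x0 hx0
  have hIm : MeasurableSet I := hIc ▸ cub_meas N x0
  have hv := vk_pos n N
  have hvol : (volume I).toReal = vk n N := by rw [hIc, cub_vol]
  have hw : CC N (I.indicator fun _ => (1:ℝ)) := by
    intro x hx y hy
    by_cases hxI : x ∈ I
    · have : y ∈ I := by rw [hN x hxI]; exact hy
      simp [hxI, this]
    · have : y ∉ I := by
        intro hyI
        apply hxI
        rw [hN y hyI, cub_eq_of_mem hy]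
        exact mem_cub_self N x
      simp [hxI, this]
  have hw0 : ∀ x, 0 ≤ (I.indicator fun _ => (1:ℝ)) x := fun x =>
    indicator_nonneg (fun _ _ => zero_le_one) x
  have hw1 : ∀ x, (I.indicator fun _ => (1:ℝ)) x ≤ 1 := fun x =>
    indicator_le_self' (fun _ _ => zero_le_one) x
  have hwint : ∀ u : (Fin n → ℝ) → ℝ,
      ∫ x in unitCube n, (I.indicator fun _ => (1:ℝ)) x * u x = ∫ x in I, u x := by
    intro u
    have : (fun x => (I.indicator fun _ => (1:ℝ)) x * u x) = I.indicator u := by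
      ext x
      by_cases hx : x ∈ I <;> simp [hx]
    rw [this, setIntegral_indicator hIm, inter_eq_right.2 hIQ]
  have hTN : ∀ m, TT p (I.indicator fun _ => (1:ℝ)) (φ m) (mx (φ m) N)
      = vk n N * hh p (mx (φ m) N x0) (avg (φ m) N x0) := by
    intro m
    rw [TT_eq hw (mx_CC (φ m) N) (hφi m), hwint]
    have hcc : CC N fun y => hh p (mx (φ m) N y) (avg (φ m) N y) := by
      intro y hy w hw
      simp only [mx_CC (φ m) N y hy w hw, avg_CC (φ m) N y hy w hw]
    conv_lhs => rw [hIc]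
    exact hcc.integral_cub hxQ
  have hTNlim : Tendsto (fun m => TT p (I.indicator fun _ => (1:ℝ)) (φ m) (mx (φ m) N)) atTop
      (nhds (- (vk n N * f ^ p))) := by
    simp only [hTN]
    have : - (vk n N * f ^ p) = vk n N * hh p f f := by rw [hh_self hp hf0]; ring
    rw [this]
    unfold hh
    exact ((((hK N x0 hxQ).rpow_const (Or.inr (by linarith))).const_mul _).sub
      (((hA N x0 hxQ).const_mul _).mul
        ((hK N x0 hxQ).rpow_const (Or.inr (by linarith))))).const_mul _
  have hTI : Tendsto (fun m => (p - 1) * (∫ x in I, dyadicMax n (φ m) x ^ p)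
      - p * ∫ x in I, φ m x * dyadicMax n (φ m) x ^ (p - 1)) atTop
      (nhds (- (vk n N * f ^ p))) := by
    have e : ∀ m, TT p (I.indicator fun _ => (1:ℝ)) (φ m) (dyadicMax n (φ m))
        = (p - 1) * (∫ x in I, dyadicMax n (φ m) x ^ p)
          - p * ∫ x in I, φ m x * dyadicMax n (φ m) x ^ (p - 1) := by
      intro m
      rw [← hTeq m I hIQ, ← hwint]
      rfl
    simp only [← e]
    have hlow := hTNlim.sub hdefi
    rw [sub_zero] at hlow
    refine tendsto_of_tendsto_of_tendsto_of_le_of_le hlow hTNlim (fun m => ?_) (fun m => ?_)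
    · have := TT_gap hp (hφ0 m) (hφi m) (hφp m) hw hw0 hw1
      simp only
      linarith
    · exact TT_le hp (hφ0 m) (hφi m) (hφp m) hw hw0 hw1
  have hYQ : Tendsto (fun m => ∫ x in unitCube n, (z ^ p * φ m x ^ p
      + (p - 1) * dyadicMax n (φ m) x ^ p
      - p * z * (φ m x * dyadicMax n (φ m) x ^ (p - 1)))) atTop (nhds 0) := by
    have hlim : Tendsto (fun m => z ^ p * F
        + (p - 1) * (∫ x in unitCube n, dyadicMax n (φ m) x ^ p)
        - z * ((p - 1) * (∫ x in unitCube n, dyadicMax n (φ m) x ^ p)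
          + f ^ p + defi p (φ m))) atTop
        (nhds (z ^ p * F + (p - 1) * (F * z ^ p) - z * ((p - 1) * (F * z ^ p) + f ^ p + 0))) :=
      ((h3.const_mul _).const_add _).sub
        ((((h3.const_mul _).add_const _).add hdefi).const_mul _)
    have e : z ^ p * F + (p - 1) * (F * z ^ p) - z * ((p - 1) * (F * z ^ p) + f ^ p + 0) = 0 := by
      rw [hfp, ← hsp]; ring
    rw [e] at hlim
    refine hlim.congr fun m => ?_
    rw [hYeq m z _ Subset.rfl, h2]
    unfold defi
    rw [hTT1, h1]
    ring
  have hYI : Tendsto (fun m => z ^ p * (∫ x in I, φ m x ^ p)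
      + (p - 1) * (∫ x in I, dyadicMax n (φ m) x ^ p)
      - p * z * ∫ x in I, φ m x * dyadicMax n (φ m) x ^ (p - 1)) atTop (nhds 0) := by
    simp only [← fun m => hYeq m z I hIQ]
    refine squeeze_zero (fun m => integral_nonneg (young_pt hp (hφ0 m) hz0.le)) (fun m => ?_) hYQ
    exact setIntegral_mono_set (hYint m z) (ae_of_all _ (young_pt hp (hφ0 m) hz0.le))
      hIQ.eventuallyLE
  obtain ⟨K, hKb⟩ := h3.bddAbove_range
  have hfin := final_lim (v := vk n N) (K := K) hp hf hF hz1 hzeq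
    (A := fun m => ∫ x in I, φ m x ^ p)
    (B := fun m => ∫ x in I, dyadicMax n (φ m) x ^ p)
    (C := fun m => ∫ x in I, φ m x * dyadicMax n (φ m) x ^ (p - 1))
    (fun m => integral_nonneg fun x => Real.rpow_nonneg (dyadicMax_nonneg (hφ0 m) x) _)
    (fun m => (setIntegral_mono_set (hGp m)
      (ae_of_all _ fun x => Real.rpow_nonneg (dyadicMax_nonneg (hφ0 m) x) _)
      hIQ.eventuallyLE).trans (hKb ⟨m, rfl⟩))
    (fun m s hs => by
      rw [← hYeq m s I hIQ]
      exact integral_nonneg (young_pt hp (hφ0 m) hs))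
    hYI hTI
  rw [hvol]
  have := hfin.const_mul (1 / vk n N)
  rwa [← mul_assoc, one_div_mul_cancel hv.ne', one_mul] at this
end
end
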